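/- arXiv:2206.10872 — 4 statements merged into one kernel-verified Lean document; each statement's English description precedes it below -/
import Mathlib

section
/- (1) Let z ∈ S∖XS. Then z is irreducible in S if and only if z is irreducible in T. (2) For every simple right T-module W there is an element z of S which is irreducible in both S and T such that W ≅ T/zT. -/
open MulOpposite

universe u

/-- `φ : R →+* S` and `θ : S` exhibit `S` as the skew polynomial ring `R[θ; α]`:
`θ · r = α(r) · θ`, and every element of `S` is uniquely a polynomial `Σ rᵢ θ^i`. -/
structure IsSkewPolynomialRing {R S : Type u} [CommRing R] [Ring S]
    (α : R ≃+* R) (φ : R →+* S) (θ : S) : Prop where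
  commutes : ∀ r : R, θ * φ r = φ (α r) * θ
  bijective : Function.Bijective fun p : ℕ →₀ R => p.sum fun n r => φ r * θ ^ n

/-- `ψ : S →+* T` exhibits `T` as the (Ore) localization of `S` inverting the
powers of the normal element `x`. -/
structure IsLocalizationAt {S T : Type u} [Ring S] [Ring T] (x : S) (ψ : S →+* T) : Prop where
  inj : Function.Injective ψ
  unit : IsUnit (ψ x)
  surj : ∀ t : T, ∃ (s : S) (n : ℕ), t * ψ x ^ n = ψ s

/-- The right ideal `zS`. -/
abbrev rSpan (S : Type u) [Ring S] (z : S) : Submodule Sᵐᵒᵖ S := Submodule.span Sᵐᵒᵖ {z}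

/-- The left ideal `Sz`. -/
abbrev lSpan (S : Type u) [Ring S] (z : S) : Submodule S S := Submodule.span S {z}

/-- The cyclic right `S`-module `S/zS`. -/
abbrev rQuot (S : Type u) [Ring S] (z : S) : Type u := S ⧸ rSpan S z

/-- The cyclic left `S`-module `S/Sz`. -/
abbrev lQuot (S : Type u) [Ring S] (z : S) : Type u := S ⧸ lSpan S z

/-- The cyclic right `S`-module `S/(aS + bS)`. -/
abbrev rQuot2 (S : Type u) [Ring S] (a b : S) : Type u := S ⧸ (rSpan S a ⊔ rSpan S b)

/-- Two elements of `T` are similar if `T/aT ≅ T/bT` as right `T`-modules. -/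
def SimilarIn (T : Type u) [Ring T] (a b : T) : Prop :=
  Nonempty (rQuot T a ≃ₗ[Tᵐᵒᵖ] rQuot T b)

/-- The image in `S` of a polynomial `p ∈ k[θ]`, i.e. `Σ φ(pᵢ) θ^i`. -/
def thetaPoly {k R S : Type u} [CommSemiring k] [CommRing R] [Ring S] [Algebra k R]
    (φ : R →+* S) (θ : S) (p : Polynomial k) : S :=
  p.sum fun n c => φ (algebraMap k R c) * θ ^ n

/-- Type (A) irreducibles of `S = R[θ; α]`: unit multiples of `X` or `θ`. -/
def IsTypeA {R S : Type u} [CommRing R] [Ring S] (X : R) (φ : R →+* S) (θ : S) (z : S) : Prop :=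
  ∃ u : Sˣ, (u : S) * z = φ X ∨ (u : S) * z = θ

/-- Type (B) irreducibles of `S = R[θ; α]`: unit multiples of `1 + Xs`, `s ∈ S∖R`. -/
def IsTypeB {R S : Type u} [CommRing R] [Ring S] (X : R) (φ : R →+* S) (z : S) : Prop :=
  ∃ (u : Sˣ) (s : S), s ∉ Set.range φ ∧ (u : S) * z = 1 + φ X * s

/-- Type (C) irreducibles of `S = R[θ; α]`: unit multiples of `f + Xs` with
`f ∈ k[θ]∖k` monic and the element not equal to `θ`. -/
def IsTypeC (k : Type u) {R S : Type u} [CommSemiring k] [CommRing R] [Ring S] [Algebra k R]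
    (X : R) (φ : R →+* S) (θ : S) (z : S) : Prop :=
  ∃ (u : Sˣ) (p : Polynomial k) (s : S), p.Monic ∧ 1 ≤ p.natDegree ∧
    (u : S) * z = thetaPoly φ θ p + φ X * s ∧ (u : S) * z ≠ θ

/-- A module is locally Artinian if all its finitely generated submodules are Artinian. -/
def IsLocallyArtinian (A M : Type u) [Ring A] [AddCommGroup M] [Module A M] : Prop :=
  ∀ N : Submodule A M, N.FG → IsArtinian A N

/-- A submodule is essential if it meets every nonzero submodule nontrivially. -/
def IsEssentialSubmodule {A : Type u} [Ring A] {E : Type u} [AddCommGroup E] [Module A E]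
    (U : Submodule A E) : Prop :=
  ∀ W : Submodule A E, W ≠ ⊥ → W ⊓ U ≠ ⊥

/-- `f : V →ₗ[A] E` exhibits `E` as an injective hull of `V`. -/
def IsInjectiveHullVia (A : Type u) [Ring A] {V E : Type u} [AddCommGroup V] [Module A V]
    [AddCommGroup E] [Module A E] (f : V →ₗ[A] E) : Prop :=
  Module.Injective A E ∧ Function.Injective f ∧ IsEssentialSubmodule (LinearMap.range f)

/-- Property (◊) for left `A`-modules: the injective hull of every simple left `A`-module
is locally Artinian.  (Apply with `A = Sᵐᵒᵖ` for the right-module version.) -/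
def HasDiamond (A : Type u) [Ring A] : Prop :=
  ∀ (V E : Type u) [AddCommGroup V] [Module A V] [AddCommGroup E] [Module A E]
    (f : V →ₗ[A] E), IsSimpleModule A V → IsInjectiveHullVia A f → IsLocallyArtinian A E

/-- Gabriel–Rentschler Krull dimension at most `n`; the base case `n = 0` is
`Artinian`, and `Kdim M ≤ n + 1` iff in every descending chain of submodules almost
all successive factors have Krull dimension at most `n`. -/
def KdimLE (A : Type u) [Ring A] : ℕ → ∀ (M : Type u) [AddCommGroup M] [Module A M], Prop
  | 0, M, _, _ => IsArtinian A M
  | n + 1, M, _, _ =>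
      ∀ f : ℕ → Submodule A M, (∀ i, f (i + 1) ≤ f i) →
        ∃ N : ℕ, ∀ i, N ≤ i →
          KdimLE A n (↥(f i) ⧸ Submodule.comap (f i).subtype (f (i + 1)))

/-- A `1`-critical module: Krull dimension exactly `1`, and all proper factors of
Krull dimension `< 1`, i.e. Artinian. -/
def IsOneCritical (A : Type u) [Ring A] (M : Type u) [AddCommGroup M] [Module A M] : Prop :=
  KdimLE A 1 M ∧ ¬ IsArtinian A M ∧ ∀ N : Submodule A M, N ≠ ⊥ → IsArtinian A (M ⧸ N)

/-- A right `S`-module is `𝒳`-torsion free (`𝒳 = {xⁿ}`). -/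
def IsXTorsionFree {S : Type u} [Ring S] (x : S) (M : Type u) [AddCommGroup M]
    [Module Sᵐᵒᵖ M] : Prop :=
  ∀ (m : M) (n : ℕ), op (x ^ n) • m = 0 → m = 0

/-- A right `S`-module is `𝒳`-torsion (`𝒳 = {xⁿ}`). -/
def IsXTorsion {S : Type u} [Ring S] (x : S) (M : Type u) [AddCommGroup M]
    [Module Sᵐᵒᵖ M] : Prop :=
  ∀ m : M, ∃ n : ℕ, op (x ^ n) • m = 0

/-- The central embedding of `k` into `Sᵐᵒᵖ` coming from `k → R → S`. -/
def opScalars {k R S : Type u} [CommSemiring k] [CommRing R] [Ring S] [Algebra k R]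
    (φ : R →+* S) : k →+* Sᵐᵒᵖ where
  toFun c := op (φ (algebraMap k R c))
  map_one' := by simp
  map_mul' x y := by
    show op (φ (algebraMap k R (x * y))) = op (φ (algebraMap k R x)) * op (φ (algebraMap k R y))
    rw [mul_comm x y, map_mul, map_mul, op_mul]
  map_zero' := by simp
  map_add' x y := by
    show op (φ (algebraMap k R (x + y))) = op (φ (algebraMap k R x)) + op (φ (algebraMap k R y))
    rw [map_add, map_add, op_add]

/-- A right `S`-module is finite dimensional over the central subfield `k`. -/
def FinDimOver (k : Type u) {R S : Type u} [Field k] [CommRing R] [Ring S] [Algebra k R]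
    (φ : R →+* S) (M : Type u) [AddCommGroup M] [Module Sᵐᵒᵖ M] : Prop :=
  letI : Module k M := Module.compHom M (opScalars φ)
  Module.Finite k M

/-- A left `S`-module is finite dimensional over the central subfield `k`. -/
def FinDimOverLeft (k : Type u) {R S : Type u} [Field k] [CommRing R] [Ring S] [Algebra k R]
    (φ : R →+* S) (M : Type u) [AddCommGroup M] [Module S M] : Prop :=
  letI : Module k M := Module.compHom M (φ.comp (algebraMap k R))
  Module.Finite k M

/-- `Ext¹_A(U, V) = 0`: every short exact sequence `0 → V → Y → U → 0` splits. -/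
def ExtVanish (A : Type u) [Ring A] (U V : Type u) [AddCommGroup U] [Module A U]
    [AddCommGroup V] [Module A V] : Prop :=
  ∀ (Y : Type u) [AddCommGroup Y] [Module A Y] (i : V →ₗ[A] Y) (p : Y →ₗ[A] U),
    Function.Injective i → Function.Surjective p → LinearMap.range i = LinearMap.ker p →
    ∃ r : Y →ₗ[A] V, r.comp i = LinearMap.id

/-- The right `S`-module `V` is isomorphic, as an `S`-module, to the right `T`-module `Q`
(`T` an `S`-ring via `ψ`). -/
def SModIsoOfT {S T : Type u} [Ring S] [Ring T] (ψ : S →+* T)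
    (V : Type u) [AddCommGroup V] [Module Sᵐᵒᵖ V]
    (Q : Type u) [AddCommGroup Q] [Module Tᵐᵒᵖ Q] : Prop :=
  ∃ e : V ≃+ Q, ∀ (s : S) (v : V), e (op s • v) = op (ψ s) • e v

/-- Two modules are hull-similar: they contain nonzero isomorphic submodules
(equivalently, their injective hulls are isomorphic). -/
def HullSimilar (A : Type u) [Ring A] (M N : Type u) [AddCommGroup M] [Module A M]
    [AddCommGroup N] [Module A N] : Prop :=
  ∃ (P : Submodule A M) (Q : Submodule A N), P ≠ ⊥ ∧ Q ≠ ⊥ ∧ Nonempty (P ≃ₗ[A] Q)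

/-- Restriction of scalars along `ψ : S →+* T` for right modules. -/
def restrictOp {S T : Type u} [Ring S] [Ring T] (ψ : S →+* T)
    (E : Type u) [AddCommGroup E] [Module Tᵐᵒᵖ E] : Module Sᵐᵒᵖ E :=
  Module.compHom E (RingHom.op ψ)

/-- `f : V →+ E` exhibits `E` as an injective hull of the `A`-module `V`,
where `f` is additionally required to be `A`-linear. -/
def IsInjectiveHullViaAdd (A : Type u) [Ring A] {V E : Type u} [AddCommGroup V] [Module A V]
    [AddCommGroup E] [Module A E] (f : V →+ E) : Prop :=
  Module.Injective A E ∧ Function.Injective f ∧ (∀ (a : A) (v : V), f (a • v) = a • f v) ∧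
    ∀ W : Submodule A E, W ≠ ⊥ → ∃ x : E, x ≠ 0 ∧ x ∈ W ∧ x ∈ Set.range f

section helpers

variable {k : Type u} [Field k] {R : Type u} [CommRing R] [Algebra k R]

theorem skew_theta_pow {S : Type u} [Ring S] (α : R ≃ₐ[k] R) (φ : R →+* S) (θ : S)
    (hS : IsSkewPolynomialRing α.toRingEquiv φ θ) (i : ℕ) (b : R) :
    θ ^ i * φ b = φ ((α ^ i) b) * θ ^ i := by
  induction i generalizing b with
  | zero => simp
  | succ n ih =>
    have h : θ * φ b = φ (α b) * θ := hS.commutes b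
    rw [pow_succ, mul_assoc, h, ← mul_assoc, ih, mul_assoc, pow_succ]
    rfl

/-- coefficient map, abstractly -/
theorem skew_exists_coeff {S : Type u} [Ring S] (α : R ≃ₐ[k] R) (φ : R →+* S) (θ : S)
    (hS : IsSkewPolynomialRing α.toRingEquiv φ θ) :
    ∃ c : S ≃+ (ℕ →₀ R),
      (∀ s t n, c (s * t) n = ∑ x ∈ Finset.HasAntidiagonal.antidiagonal n, c s x.1 * (α ^ x.1) (c t x.2)) ∧
      (∀ r i, c (φ r * θ ^ i) = Finsupp.single i r) := by
  let P : (ℕ →₀ R) →+ S :=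
    { toFun := fun p => p.sum fun n r => φ r * θ ^ n
      map_zero' := by simp
      map_add' := fun p q => by
        apply Finsupp.sum_add_index'
        · simp
        · intro a b c; simp [add_mul] }
  have hP : Function.Bijective P := hS.bijective
  let e : (ℕ →₀ R) ≃+ S := AddEquiv.ofBijective P hP
  have hsingle : ∀ r i, e (Finsupp.single i r) = φ r * θ ^ i := by
    intro r i
    change (Finsupp.single i r).sum (fun n r => φ r * θ ^ n) = _
    simp
  have hc : ∀ r i, e.symm (φ r * θ ^ i) = Finsupp.single i r := by
    intro r i
    rw [← hsingle, AddEquiv.symm_apply_apply]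
  refine ⟨e.symm, ?_, hc⟩
  intro s t n
  obtain ⟨p, rfl⟩ := e.surjective s
  obtain ⟨q, rfl⟩ := e.surjective t
  simp only [AddEquiv.symm_apply_apply]
  induction p using Finsupp.induction_linear with
  | zero => simp
  | add p p' h h' =>
    simp only [map_add, add_mul, Finsupp.add_apply, h, h', Finset.sum_add_distrib]
  | single i a =>
    induction q using Finsupp.induction_linear with
    | zero => simp
    | add p p' h h' =>
      simp only [map_add, mul_add, Finsupp.add_apply, h, h', Finset.sum_add_distrib]
    | single j b =>
      have : e (Finsupp.single i a) * e (Finsupp.single j b)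
          = φ (a * (α ^ i) b) * θ ^ (i + j) := by
        rw [hsingle, hsingle, mul_assoc, ← mul_assoc (θ ^ i), skew_theta_pow α φ θ hS]
        simp [pow_add, mul_assoc]
      rw [this, hc]
      by_cases hn : i + j = n
      · rw [Finset.sum_eq_single (i, j)]
        · simp [hn]
        · rintro ⟨i', j'⟩ _ hne
          by_cases h1 : i = i'
          · by_cases h2 : j = j'
            · subst h1 h2; exact absurd rfl hne
            · simp [Finsupp.single_apply, h2]
          · simp [Finsupp.single_apply, h1]
        · intro h; exact absurd (by simpa using hn) h
      · rw [Finset.sum_eq_zero]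
        · simp [Finsupp.single_apply, hn]
        · rintro ⟨i', j'⟩ hx
          rw [Finset.HasAntidiagonal.mem_antidiagonal] at hx
          by_cases h1 : i = i'
          · by_cases h2 : j = j'
            · subst h1 h2; exact absurd hx hn
            · simp [Finsupp.single_apply, h2]
          · simp [Finsupp.single_apply, h1]

/-- product of elements outside a stable prime is outside -/
theorem skew_prime {S : Type u} [Ring S] (α : R ≃ₐ[k] R) (c : S ≃+ (ℕ →₀ R))
    (hmul : ∀ s t n, c (s * t) n = ∑ x ∈ Finset.HasAntidiagonal.antidiagonal n, c s x.1 * (α ^ x.1) (c t x.2))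
    (P : Ideal R) [P.IsPrime] (hP : ∀ (i : ℕ) r, (α ^ i) r ∈ P ↔ r ∈ P)
    (s t : S) (hs : ∃ i, c s i ∉ P) (ht : ∃ i, c t i ∉ P) : ∃ i, c (s * t) i ∉ P := by
  classical
  let m := Nat.find hs
  let n := Nat.find ht
  have hm : c s m ∉ P := Nat.find_spec hs
  have hn : c t n ∉ P := Nat.find_spec ht
  refine ⟨m + n, fun h => ?_⟩
  rw [hmul, ← Finset.add_sum_erase _ _ (show (m, n) ∈ Finset.HasAntidiagonal.antidiagonal (m + n) by simp)] at h
  rw [Ideal.add_mem_iff_left] at h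
  · rcases Ideal.IsPrime.mem_or_mem ‹_› h with h | h
    · exact hm h
    · exact hn ((hP _ _).1 h)
  · apply Ideal.sum_mem
    rintro ⟨i, j⟩ hx
    rw [Finset.mem_erase, Finset.HasAntidiagonal.mem_antidiagonal] at hx
    obtain ⟨hne, hx⟩ := hx
    simp only at hx
    rcases lt_or_ge i m with h1 | h1
    · exact Ideal.mul_mem_right _ _ (not_not.1 (Nat.find_min hs h1))
    · rcases lt_or_ge j n with h2 | h2
      · exact Ideal.mul_mem_left _ _ ((hP _ _).2 (not_not.1 (Nat.find_min ht h2)))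
      · exact absurd (by ext <;> simp <;> omega) hne

theorem skew_right {S : Type u} [Ring S] (α : R ≃ₐ[k] R) (φ : R →+* S) (θ : S)
    (c : S ≃+ (ℕ →₀ R))
    (hmul : ∀ s t n, c (s * t) n = ∑ x ∈ Finset.HasAntidiagonal.antidiagonal n, c s x.1 * (α ^ x.1) (c t x.2))
    (hc : ∀ r i, c (φ r * θ ^ i) = Finsupp.single i r) (s : S) (r : R) (j i : ℕ) :
    c (s * (φ r * θ ^ j)) (i + j) = c s i * (α ^ i) r := by
  rw [hmul, Finset.sum_eq_single (i, j)]
  · simp [hc]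
  · rintro ⟨i', j'⟩ hx hne
    rw [Finset.HasAntidiagonal.mem_antidiagonal] at hx
    have : j ≠ j' := by
      rintro rfl
      exact hne (by ext <;> simp; simpa using hx)
    simp [hc, Finsupp.single_apply, this]
  · simp

theorem skew_left {S : Type u} [Ring S] (α : R ≃ₐ[k] R) (φ : R →+* S) (θ : S)
    (c : S ≃+ (ℕ →₀ R))
    (hmul : ∀ s t n, c (s * t) n = ∑ x ∈ Finset.HasAntidiagonal.antidiagonal n, c s x.1 * (α ^ x.1) (c t x.2))
    (hc : ∀ r i, c (φ r * θ ^ i) = Finsupp.single i r) (s : S) (r : R) (i : ℕ) :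
    c (φ r * s) i = r * c s i := by
  have h0 : c (φ r) = Finsupp.single 0 r := by simpa using hc r 0
  rw [hmul, Finset.sum_eq_single (0, i)]
  · simp [h0]
  · rintro ⟨i', j'⟩ hx hne
    rw [Finset.HasAntidiagonal.mem_antidiagonal] at hx
    have : 0 ≠ i' := by
      rintro rfl
      exact hne (by ext <;> simp; simpa using hx)
    simp [h0, Finsupp.single_apply, this]
  · simp

theorem skew_domain [IsDomain R] {S : Type u} [Ring S] (α : R ≃ₐ[k] R) (c : S ≃+ (ℕ →₀ R))
    (hmul : ∀ s t n, c (s * t) n =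
      ∑ x ∈ Finset.HasAntidiagonal.antidiagonal n, c s x.1 * (α ^ x.1) (c t x.2)) :
    ∀ s t : S, s * t = 0 → s = 0 ∨ t = 0 := by
  intro s t hst
  by_contra! h
  have key : ∀ s : S, s ≠ 0 → ∃ i, c s i ∉ (⊥ : Ideal R) := by
    intro s hs
    by_contra! h'
    apply hs
    apply c.injective
    ext i
    simpa using h' i
  obtain ⟨i, hi⟩ := skew_prime α c hmul ⊥ (fun i r => by
    rw [Ideal.mem_bot, Ideal.mem_bot, EmbeddingLike.map_eq_zero_iff]) s t (key s h.1) (key t h.2)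
  rw [hst] at hi
  simp at hi

end helpers

theorem irreducible_iff_and_simple_T_modules
    {k : Type u} [Field k]
    {R : Type u} [CommRing R] [IsDomain R] [IsDiscreteValuationRing R] [Algebra k R]
    (X : R) (hX : IsLocalRing.maximalIdeal R = Ideal.span {X})
    (hres : Function.Bijective ((IsLocalRing.residue R).comp (algebraMap k R)))
    (α : R ≃ₐ[k] R) (hord : ∀ n : ℕ, 0 < n → α ^ n ≠ 1)
    {S : Type u} [Ring S] (φ : R →+* S) (θ : S)
    (hS : IsSkewPolynomialRing α.toRingEquiv φ θ)
    {T : Type u} [Ring T] (ψ : S →+* T) (hT : IsLocalizationAt (φ X) ψ) :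
    (∀ z : S, (¬ ∃ s : S, z = φ X * s) → (Irreducible z ↔ Irreducible (ψ z))) ∧
    (∀ (W : Type u) [AddCommGroup W] [Module Tᵐᵒᵖ W], IsSimpleModule Tᵐᵒᵖ W →
      ∃ z : S, Irreducible z ∧ Irreducible (ψ z) ∧
        Nonempty (W ≃ₗ[Tᵐᵒᵖ] rQuot T (ψ z))) := by
  classical
  obtain ⟨c, hmul, hc⟩ := skew_exists_coeff α φ θ hS
  have hright := skew_right α φ θ c hmul hc
  have hleft := skew_left α φ θ c hmul hc
  have hright0 : ∀ (s : S) (r : R) (i : ℕ), c (s * φ r) i = c s i * (α ^ i) r := by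
    intro s r i; simpa using hright s r 0 i
  have hphi : ∀ r, c (φ r) = Finsupp.single 0 r := fun r => by simpa using hc r 0
  set M := IsLocalRing.maximalIdeal R with hM
  have hXirr : Irreducible X := (IsDiscreteValuationRing.irreducible_iff_uniformizer X).2 hX
  have hX0 : X ≠ 0 := hXirr.ne_zero
  have hunit : ∀ (i : ℕ) (r : R), IsUnit ((α ^ i) r) ↔ IsUnit r := fun i r =>
    MulEquiv.isUnit_map (α ^ i)
  have hMstab : ∀ (i : ℕ) (r : R), (α ^ i) r ∈ M ↔ r ∈ M := by
    intro i r
    rw [hM, IsLocalRing.mem_maximalIdeal, IsLocalRing.mem_maximalIdeal, mem_nonunits_iff,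
      mem_nonunits_iff, hunit]
  have hassoc : ∀ i : ℕ, Associated ((α ^ i) X) X := by
    intro i
    apply IsDiscreteValuationRing.associated_of_irreducible
    · exact (MulEquiv.irreducible_iff (α ^ i)).2 hXirr
    · exact hXirr
  let prim : S → Prop := fun s => ∃ i, c s i ∉ M
  have hprim_mul : ∀ s t, prim s → prim t → prim (s * t) :=
    fun s t => skew_prime α c hmul M hMstab s t
  have hS0 : ∀ s t : S, s * t = 0 → s = 0 ∨ t = 0 := skew_domain α c hmul
  have hprim_iff : ∀ z : S, (¬ ∃ s, z = φ X * s) ↔ prim z := by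
    intro z
    constructor
    · intro h
      by_contra! h'
      have h'' : ∀ i, ∃ r, c z i = X * r := by
        intro i
        have : c z i ∈ M := by by_contra h2; exact h' ⟨i, h2⟩
        rw [hX, Ideal.mem_span_singleton] at this
        exact this
      choose f hf using h''
      apply h
      refine ⟨c.symm (Finsupp.onFinset (c z).support f ?_), ?_⟩
      · intro i hi
        rw [Finsupp.mem_support_iff, hf]
        exact mul_ne_zero hX0 hi
      · apply c.injective
        ext i
        rw [hleft]
        simp [hf]
    · rintro ⟨i, hi⟩ ⟨s, rfl⟩
      rw [hleft, hX] at hi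
      exact hi (Ideal.mem_span_singleton.2 (Dvd.intro _ rfl))
  have hnp : ∀ s : S, ¬ prim (s * φ X) := by
    rintro s ⟨i, hi⟩
    rw [hright0] at hi
    refine hi (Ideal.mul_mem_left _ _ ((hMstab _ _).2 ?_))
    rw [hX]; exact Ideal.mem_span_singleton_self X
  have hnp' : ∀ s : S, ¬ prim s → ∃ s', s = s' * φ X := by
    intro z h'
    have h'' : ∀ i, ∃ r, c z i = r * (α ^ i) X := by
      intro i
      have : c z i ∈ M := by by_contra h2; exact h' ⟨i, h2⟩
      rw [hX, Ideal.mem_span_singleton] at this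
      obtain ⟨r, hr⟩ := (hassoc i).dvd.trans this
      exact ⟨r, by rw [hr, mul_comm]⟩
    choose f hf using h''
    refine ⟨c.symm (Finsupp.onFinset (c z).support f ?_), ?_⟩
    · intro i hi
      rw [Finsupp.mem_support_iff, hf]
      refine mul_ne_zero hi ?_
      exact (EmbeddingLike.map_ne_zero_iff).2 hX0
    · apply c.injective
      ext i
      rw [hright0]
      simp [hf]
  have hfac : ∀ s : S, s ≠ 0 → ∃ s' n, prim s' ∧ s = s' * φ X ^ n := by
    intro s hs
    have hex : ∃ n, ¬ ∃ s', s = s' * φ X ^ n := by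
      have : ∃ i, c s i ≠ 0 := by
        by_contra! h
        apply hs
        apply c.injective
        ext i
        simpa using h i
      obtain ⟨i, hi⟩ := this
      obtain ⟨n, hn⟩ := IsDiscreteValuationRing.associated_pow_irreducible hi hXirr
      refine ⟨n + 1, ?_⟩
      rintro ⟨s', rfl⟩
      rw [← map_pow, hright0] at hn hi
      have h1 : X ^ (n + 1) ∣ X ^ n := by
        refine dvd_trans ?_ hn.dvd
        refine Dvd.dvd.mul_left ?_ _
        rw [map_pow]
        exact pow_dvd_pow_of_dvd (hassoc i).symm.dvd _
      have := (pow_dvd_pow_iff hX0 hXirr.not_isUnit).1 h1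
      omega
    have hne : Nat.find hex ≠ 0 := by
      intro h0
      have := Nat.find_spec hex
      rw [h0] at this
      exact this ⟨s, by simp⟩
    obtain ⟨n, hn⟩ := Nat.exists_eq_succ_of_ne_zero hne
    have h1 := Nat.find_min hex (m := n) (by omega)
    push Not at h1
    obtain ⟨s', hs'⟩ := h1
    refine ⟨s', n, ?_, hs'⟩
    by_contra hp
    obtain ⟨s'', rfl⟩ := hnp' s' hp
    apply Nat.find_spec hex
    refine ⟨s'', ?_⟩
    rw [hn, hs', Nat.succ_eq_add_one, pow_succ', mul_assoc]
  obtain ⟨u, hu⟩ := hT.unit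
  have hprim0 : ∀ s, prim s → s ≠ 0 := by
    rintro s ⟨i, hi⟩ rfl
    simp at hi
  have hupow : ∀ n : ℕ, ((u ^ (n : ℤ) : Tˣ) : T) = ψ (φ X ^ n) := by
    intro n; simp [hu]
  have hL : ∀ t : T, t ≠ 0 → ∃ s, prim s ∧ ∃ j : ℤ, t = ψ s * ((u ^ j : Tˣ) : T) := by
    intro t ht
    obtain ⟨s, n, hs⟩ := hT.surj t
    have hs2 : t = ψ s * ((u ^ (-(n : ℤ)) : Tˣ) : T) := by
      rw [← hs, ← map_pow, ← hupow, mul_assoc, ← Units.val_mul, ← zpow_add]; simp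
    have hs0 : s ≠ 0 := by
      rintro rfl
      apply ht; rw [hs2]; simp
    obtain ⟨s', m, hp, rfl⟩ := hfac s hs0
    refine ⟨s', hp, m - n, ?_⟩
    rw [hs2, map_mul, ← hupow, mul_assoc, ← Units.val_mul, ← zpow_add]; rfl
  have hU1 : ∀ s s' (n : ℕ), prim s → ψ s = ψ s' * ((u ^ (n : ℤ) : Tˣ) : T) → n = 0 := by
    intro s s' n hp h
    rcases n with _ | n
    · rfl
    rw [hupow, ← map_mul] at h
    rw [hT.inj h, pow_succ, ← mul_assoc] at hp
    exact absurd hp (hnp _)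
  have hU : ∀ s s' (j : ℤ), prim s → prim s' → ψ s = ψ s' * ((u ^ j : Tˣ) : T) → j = 0 := by
    intro s s' j hp hp' h
    obtain ⟨n, rfl | rfl⟩ := j.eq_nat_or_neg
    · simpa using hU1 s s' n hp h
    · have : ψ s' = ψ s * ((u ^ (n : ℤ) : Tˣ) : T) := by
        rw [h, mul_assoc, ← Units.val_mul, ← zpow_add]; simp
      simpa using hU1 s' s n hp' this
  have hone : prim 1 := by
    refine ⟨0, ?_⟩
    have := hphi 1
    rw [map_one] at this
    rw [this]
    rw [Finsupp.single_eq_same]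
    exact (Ideal.ne_top_iff_one _).1 (IsLocalRing.maximalIdeal.isMaximal R).ne_top
  have hS_nz : NoZeroDivisors S := ⟨fun {a b} h => hS0 a b h⟩
  have hT_nz : NoZeroDivisors T := by
    refine ⟨fun {a b} h => ?_⟩
    by_contra! hne
    obtain ⟨s, hs, i, rfl⟩ := hL a hne.1
    obtain ⟨s', hs', j, hj⟩ := hL (((u ^ i : Tˣ) : T) * b) (by simpa using hne.2)
    rw [mul_assoc, hj, ← mul_assoc, Units.mul_left_eq_zero, ← map_mul,
      map_eq_zero_iff ψ hT.inj] at h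
    exact hprim0 _ (hprim_mul _ _ hs hs') h
  have hcomm : ∀ {A : Type u} [Ring A] [NoZeroDivisors A] (a b : A), a * b = 1 → b * a = 1 := by
    intro A _ _ a b h
    rcases subsingleton_or_nontrivial A with _ | _
    · exact Subsingleton.elim _ _
    have hb : b ≠ 0 := by rintro rfl; simp at h
    apply mul_right_cancel₀ hb
    rw [mul_assoc, h, mul_one, one_mul]
  have hSnt : Nontrivial S := ⟨1, 0, hprim0 1 hone⟩
  have hTnt : Nontrivial T := hT.inj.nontrivial
  have hunit2 : ∀ z, prim z → IsUnit (ψ z) → IsUnit z := by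
    rintro z hz ⟨v, hv⟩
    obtain ⟨s, hs, j, hj⟩ := hL _ v⁻¹.ne_zero
    have h1 : ψ 1 = ψ (z * s) * ((u ^ j : Tˣ) : T) := by
      rw [map_mul, mul_assoc, ← hj, ← hv]; simp
    have h2 := hU _ _ _ hone (hprim_mul _ _ hz hs) h1
    rw [h2] at h1
    simp only [zpow_zero, Units.val_one, mul_one] at h1
    have h3 : z * s = 1 := (hT.inj h1).symm
    exact ⟨⟨z, s, h3, hcomm _ _ h3⟩, rfl⟩
  have part1 : ∀ z, prim z → (Irreducible z ↔ Irreducible (ψ z)) := by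
    intro z hz
    constructor
    · intro hirr
      refine ⟨fun h => hirr.not_isUnit (hunit2 z hz h), ?_⟩
      intro a b hab
      have hz0 : ψ z ≠ 0 := fun h => hprim0 z hz ((map_eq_zero_iff ψ hT.inj).1 h)
      have ha : a ≠ 0 := by rintro rfl; simp [hab] at hz0
      have hb : b ≠ 0 := by rintro rfl; simp [hab] at hz0
      obtain ⟨s, hs, i, rfl⟩ := hL a ha
      obtain ⟨s', hs', j, hj⟩ := hL (((u ^ i : Tˣ) : T) * b) (by simpa using hb)
      rw [mul_assoc, hj, ← mul_assoc, ← map_mul] at hab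
      have h2 := hU _ _ _ hz (hprim_mul _ _ hs hs') hab
      rw [h2] at hab hj
      simp only [zpow_zero, Units.val_one, mul_one] at hab hj
      rcases hirr.isUnit_or_isUnit (hT.inj hab) with h | h
      · left
        exact (h.map ψ).mul (Units.isUnit _)
      · right
        rw [← Units.isUnit_units_mul (u ^ i), hj]
        exact h.map ψ
    · intro hirr
      refine ⟨fun h => hirr.not_isUnit (h.map ψ), ?_⟩
      rintro a b rfl
      have ha : prim a := by
        rw [← hprim_iff] at hz ⊢
        rintro ⟨s, rfl⟩
        exact hz ⟨s * b, by rw [mul_assoc]⟩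
      have hb : prim b := by
        by_contra h
        obtain ⟨s, rfl⟩ := hnp' b h
        rw [← mul_assoc] at hz
        exact hnp _ hz
      rw [map_mul] at hirr
      rcases hirr.isUnit_or_isUnit rfl with h | h
      · exact Or.inl (hunit2 a ha h)
      · exact Or.inr (hunit2 b hb h)
  have hmem : ∀ a b : T, b ∈ rSpan T a ↔ ∃ t, b = a * t := by
    intro a b
    rw [Submodule.mem_span_singleton]
    constructor
    · rintro ⟨t, rfl⟩; exact ⟨unop t, rfl⟩
    · rintro ⟨t, rfl⟩; exact ⟨op t, rfl⟩
  have hmulI : ∀ (I : Submodule Tᵐᵒᵖ T) (a t : T), a ∈ I → a * t ∈ I :=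
    fun I a t ha => I.smul_mem (op t) ha
  -- principal right ideals
  have hPID : ∀ I : Submodule Tᵐᵒᵖ T, I ≠ ⊥ → ∃ z, prim z ∧ I = rSpan T (ψ z) := by
    intro I hI
    have hex : ∃ n, ∃ g : S, ψ g ∈ I ∧ c g n ≠ 0 ∧ ∀ i, n < i → c g i = 0 := by
      obtain ⟨t, htI, ht0⟩ := Submodule.exists_mem_ne_zero_of_ne_bot hI
      obtain ⟨s, hs, j, rfl⟩ := hL t ht0
      have hs0 := hprim0 s hs
      have hsupp : (c s).support.Nonempty := by
        rw [Finsupp.support_nonempty_iff]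
        simpa using hs0
      refine ⟨(c s).support.max' hsupp, s, ?_, ?_, ?_⟩
      · have := hmulI I _ ((u ^ (-j) : Tˣ) : T) htI
        rwa [mul_assoc, ← Units.val_mul, ← zpow_add, add_neg_cancel, zpow_zero, Units.val_one,
          mul_one] at this
      · exact Finsupp.mem_support_iff.1 (Finset.max'_mem _ _)
      · intro i hi
        by_contra hne
        have := Finset.le_max' _ i (Finsupp.mem_support_iff.2 hne)
        omega
    obtain ⟨g, hgI, hgm, hgd⟩ := Nat.find_spec hex
    have hmin : ∀ n, n < Nat.find hex → ∀ f : S, ψ f ∈ I → (∀ i, n < i → c f i = 0) →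
        c f n = 0 := by
      intro n hn f hf hd
      by_contra hne
      exact Nat.find_min hex hn ⟨f, hf, hne, hd⟩
    set m := Nat.find hex with hm
    have key : ∀ n, ∀ f : S, ψ f ∈ I → (∀ i, n ≤ i → c f i = 0) → ψ f ∈ rSpan T (ψ g) := by
      intro n
      induction n with
      | zero =>
        intro f _ hd
        have : f = 0 := by
          apply c.injective
          ext i
          simpa using hd i (Nat.zero_le _)
        rw [this]; simp
      | succ n ih =>
        intro f hf hd
        rcases lt_or_ge n m with hnm | hnm
        · apply ih f hf
          intro i hi
          rcases hi.eq_or_lt with rfl | hi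
          · exact hmin _ hnm f hf (fun i hi => hd i hi)
          · exact hd i hi
        · obtain ⟨e, he⟩ := IsDiscreteValuationRing.associated_pow_irreducible hgm hXirr
          have hdvd : c g m ∣ c f n * (α ^ n) (X ^ e) := by
            refine he.dvd.trans (Dvd.dvd.mul_left ?_ _)
            rw [map_pow]
            exact pow_dvd_pow_of_dvd (hassoc n).symm.dvd _
          obtain ⟨d', hd'⟩ := hdvd
          obtain ⟨d, rfl⟩ := (α ^ m).surjective d'
          obtain ⟨l, rfl⟩ := Nat.exists_eq_add_of_le hnm
          have h1 : ψ (f * φ (X ^ e) - g * (φ d * θ ^ l)) ∈ rSpan T (ψ g) := by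
            apply ih
            · rw [map_sub, map_mul, map_mul]
              exact I.sub_mem (hmulI I _ _ hf) (hmulI I _ _ hgI)
            · intro i hi
              obtain ⟨i', rfl⟩ := Nat.exists_eq_add_of_le hi
              have e1 : m + l + i' = (m + i') + l := by omega
              rw [map_sub, Finsupp.sub_apply, hright0]
              rw [e1, hright, ← e1]
              rcases Nat.eq_zero_or_pos i' with rfl | hi'
              · simp only [add_zero]
                rw [hd', sub_self]
              · rw [hd _ (by omega), hgd _ (by omega)]; simp
          rw [map_sub, map_mul, map_mul] at h1
          have h2 : ψ g * ψ (φ d * θ ^ l) ∈ rSpan T (ψ g) := (hmem _ _).2 ⟨_, rfl⟩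
          have h3 := (rSpan T (ψ g)).add_mem h1 h2
          rw [sub_add_cancel, map_pow, ← hupow] at h3
          have h4 := hmulI _ _ ((u ^ (-(e : ℤ)) : Tˣ) : T) h3
          rwa [mul_assoc, ← Units.val_mul, ← zpow_add, add_neg_cancel, zpow_zero, Units.val_one,
            mul_one] at h4
    have hIg : I = rSpan T (ψ g) := by
      apply le_antisymm
      · intro t ht
        obtain ⟨s, n, hs⟩ := hT.surj t
        rw [← map_pow, ← hupow] at hs
        have hsI : ψ s ∈ I := hs ▸ hmulI I _ _ ht
        have h3 : ψ s ∈ rSpan T (ψ g) := by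
          refine key ((c s).support.sup id + 1) s hsI ?_
          intro i hi
          by_contra hne
          have := Finset.le_sup (f := id) (Finsupp.mem_support_iff.2 hne)
          simp only [id] at this
          omega
        rw [← hs] at h3
        have h4 := hmulI _ _ ((u ^ (-(n : ℤ)) : Tˣ) : T) h3
        rwa [mul_assoc, ← Units.val_mul, ← zpow_add, add_neg_cancel, zpow_zero, Units.val_one,
            mul_one] at h4
      · rw [Submodule.span_le]
        simpa using hgI
    have hg0 : g ≠ 0 := by rintro rfl; simp at hgm
    obtain ⟨z, n, hz, rfl⟩ := hfac g hg0
    refine ⟨z, hz, ?_⟩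
    rw [hIg, map_mul, ← hupow]
    ext t
    rw [hmem, hmem]
    constructor
    · rintro ⟨t, rfl⟩; exact ⟨_, mul_assoc _ _ _⟩
    · rintro ⟨t, rfl⟩
      refine ⟨((u ^ (-(n : ℤ)) : Tˣ) : T) * t, ?_⟩
      rw [mul_assoc, ← mul_assoc _ _ t, ← Units.val_mul, ← zpow_add, add_neg_cancel, zpow_zero,
        Units.val_one, one_mul]
  refine ⟨fun z hz => part1 z ((hprim_iff z).1 hz), ?_⟩
  intro W _ _ hW
  haveI : Nontrivial W := IsSimpleModule.nontrivial Tᵐᵒᵖ W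
  obtain ⟨w, hw⟩ := exists_ne (0 : W)
  let f : T →ₗ[Tᵐᵒᵖ] W :=
    { toFun := fun t => op t • w
      map_add' := fun a b => by simp [add_smul]
      map_smul' := fun a b => by
        change op (b * unop a) • w = a • op b • w
        rw [op_mul, mul_smul, op_unop] }
  have hf : Function.Surjective f := by
    rw [← LinearMap.range_eq_top]
    rcases eq_bot_or_eq_top (LinearMap.range f) with h | h
    · exfalso
      have : f 1 ∈ LinearMap.range f := ⟨1, rfl⟩
      rw [h, Submodule.mem_bot] at this
      exact hw (by simpa [f] using this)
    · exact h
  let E := f.quotKerEquivOfSurjective hf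
  have hco : IsCoatom (LinearMap.ker f) := by
    rw [← isSimpleModule_iff_isCoatom]
    exact IsSimpleModule.congr E
  have hker : LinearMap.ker f ≠ ⊥ := by
    intro hbot
    rw [hbot] at hco
    have hθ0 : θ ≠ 0 := by
      intro h
      have := hc 1 1
      rw [h] at this
      have h1 := congrArg (fun p => p 1) this
      simp at h1
    have h1 : ψ θ ∈ rSpan T (ψ θ) := (hmem _ _).2 ⟨1, by simp⟩
    have h2 : rSpan T (ψ θ) = ⊤ := by
      apply hco.2
      rw [bot_lt_iff_ne_bot]
      intro h
      rw [h, Submodule.mem_bot, map_eq_zero_iff ψ hT.inj] at h1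
      exact hθ0 h1
    have h3 : (1 : T) ∈ rSpan T (ψ θ) := by rw [h2]; trivial
    obtain ⟨t, ht⟩ := (hmem _ _).1 h3
    obtain ⟨s, n, hs⟩ := hT.surj t
    have h4 : φ (X ^ n) = θ * s := by
      apply hT.inj
      rw [map_mul, ← hs, ← mul_assoc, ← ht, one_mul, map_pow, map_pow]
    have h5 := (show c (φ (X ^ n)) 0 = c (θ * s) 0 by rw [h4])
    have hθ : c θ = Finsupp.single 1 1 := by simpa using hc 1 1
    rw [hphi, hmul, Finset.sum_eq_zero] at h5
    · simp [hX0] at h5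
    · rintro ⟨i, j⟩ hx
      rw [Finset.HasAntidiagonal.mem_antidiagonal] at hx
      have : i = 0 := by simp only at hx; omega
      simp [hθ, this]
  obtain ⟨z, hz, hzk⟩ := hPID _ hker
  have hirr : Irreducible (ψ z) := by
    have hz0 : ψ z ≠ 0 := fun h => hprim0 z hz ((map_eq_zero_iff ψ hT.inj).1 h)
    constructor
    · rintro ⟨v, hv⟩
      apply hco.1
      rw [hzk, eq_top_iff]
      intro t _
      rw [hmem, ← hv]
      exact ⟨(v⁻¹ : Tˣ) * t, by simp⟩
    · intro a b hab
      have hle : LinearMap.ker f ≤ rSpan T a := by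
        rw [hzk]
        intro t ht
        obtain ⟨t, rfl⟩ := (hmem _ _).1 ht
        rw [hmem, hab]
        exact ⟨b * t, mul_assoc _ _ _⟩
      rcases hle.eq_or_lt with h | h
      · right
        have : a ∈ LinearMap.ker f := by rw [h]; exact (hmem _ _).2 ⟨1, by simp⟩
        rw [hzk] at this
        obtain ⟨d, hd⟩ := (hmem _ _).1 this
        have h1 : d * b = 1 := by
          apply mul_left_cancel₀ hz0
          rw [← mul_assoc, ← hd, ← hab, mul_one]
        exact ⟨⟨b, d, hcomm _ _ h1, h1⟩, rfl⟩
      · left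
        have h1 : (1 : T) ∈ rSpan T a := by rw [hco.2 _ h]; trivial
        obtain ⟨d, hd⟩ := (hmem _ _).1 h1
        exact ⟨⟨a, d, hd.symm, hcomm _ _ hd.symm⟩, rfl⟩
  refine ⟨z, (part1 z hz).2 hirr, hirr, ⟨?_⟩⟩
  exact E.symm.trans (Submodule.quotEquivOfEq _ _ hzk)
end

section
/- Let z ∈ S∖XS. Then: (1) S ∩ zT = zS; (2) the right S-module S/zS is 𝒳-torsion free. -/
open MulOpposite

universe u

/-- Let `z ∈ S∖XS`.  Then (1) `S ∩ zT = zS`, and (2) the right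
`S`-module `S/zS` is `𝒳`-torsion free. -/
theorem intersection_and_torsion_free
    {k : Type u} [Field k]
    {R : Type u} [CommRing R] [IsDomain R] [IsDiscreteValuationRing R] [Algebra k R]
    (X : R) (hX : IsLocalRing.maximalIdeal R = Ideal.span {X})
    (hres : Function.Bijective ((IsLocalRing.residue R).comp (algebraMap k R)))
    (α : R ≃ₐ[k] R) (hord : ∀ n : ℕ, 0 < n → α ^ n ≠ 1)
    {S : Type u} [Ring S] (φ : R →+* S) (θ : S)
    (hS : IsSkewPolynomialRing α.toRingEquiv φ θ)
    {T : Type u} [Ring T] (ψ : S →+* T) (hT : IsLocalizationAt (φ X) ψ)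
    (z : S) (hz : ¬ ∃ s : S, z = φ X * s) :
    (∀ s : S, (∃ t : T, ψ s = ψ z * t) ↔ ∃ s' : S, s = z * s') ∧
    IsXTorsionFree (φ X) (rQuot S z) := by
  classical
  have hR0 : ∀ r : R, IsLocalRing.residue R r = 0 ↔ ∃ c, r = X * c := by
    intro r
    rw [IsLocalRing.residue_eq_zero_iff, hX, Ideal.mem_span_singleton]
    rfl
  have hαM : ∀ β : R ≃ₐ[k] R, ∀ r : R, IsLocalRing.residue R r = 0 →
      IsLocalRing.residue R (β r) = 0 := by
    intro β r hr
    rw [IsLocalRing.residue_eq_zero_iff, IsLocalRing.mem_maximalIdeal, mem_nonunits_iff] at hr ⊢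
    intro h
    apply hr
    simpa using h.map β.symm
  have hαres : ∀ r : R, IsLocalRing.residue R (α r) = IsLocalRing.residue R r := by
    intro r
    obtain ⟨c, hc⟩ := hres.2 (IsLocalRing.residue R r)
    have h0 : IsLocalRing.residue R (r - algebraMap k R c) = 0 := by
      rw [map_sub, ← hc]; simp
    have h1 := hαM α _ h0
    rw [map_sub, map_sub, AlgEquiv.commutes, sub_eq_zero] at h1
    rw [h1]; exact hc
  have hαpow : ∀ (n : ℕ) (r : R), IsLocalRing.residue R ((α ^ n) r) = IsLocalRing.residue R r := by
    intro n
    induction n with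
    | zero => intro r; simp
    | succ n ih => intro r; rw [pow_succ', AlgEquiv.mul_apply, hαres, ih]
  have hcomm : ∀ (n : ℕ) (r : R), θ ^ n * φ r = φ ((α ^ n) r) * θ ^ n := by
    intro n
    induction n with
    | zero => intro r; simp
    | succ n ih =>
      intro r
      have h := hS.commutes ((α ^ n) r)
      have h' : α.toRingEquiv ((α ^ n) r) = (α ^ (n + 1)) r := by
        rw [pow_succ', AlgEquiv.mul_apply]; rfl
      rw [h'] at h
      rw [pow_succ', mul_assoc, ih, ← mul_assoc, h, mul_assoc]
  -- the additive isomorphism from finitely supported functions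
  let E : (ℕ →₀ R) →+ S := Finsupp.liftAddHom fun n =>
    (AddMonoidHom.mulRight (θ ^ n)).comp φ.toAddMonoidHom
  have hE1 : ∀ n r, E (Finsupp.single n r) = φ r * θ ^ n := by
    intro n r; simp [E]
  have hEapp : ∀ p : ℕ →₀ R, E p = p.sum fun n r => φ r * θ ^ n := by
    intro p; rfl
  have hEb : Function.Bijective E := by
    have : (E : (ℕ →₀ R) → S) = fun p : ℕ →₀ R => p.sum fun n r => φ r * θ ^ n := funext hEapp
    rw [this]; exact hS.bijective
  let e : (ℕ →₀ R) ≃+ S := AddEquiv.ofBijective E hEb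
  have he : ∀ p, e p = E p := fun p => rfl
  let G : (ℕ →₀ R) →+ Polynomial (IsLocalRing.ResidueField R) := Finsupp.liftAddHom fun n =>
    (Polynomial.monomial n).toAddMonoidHom.comp (IsLocalRing.residue R).toAddMonoidHom
  have hG1 : ∀ n r, G (Finsupp.single n r) = Polynomial.monomial n (IsLocalRing.residue R r) := by
    intro n r; simp [G]
  have hGc : ∀ (p : ℕ →₀ R) (n : ℕ), (G p).coeff n = IsLocalRing.residue R (p n) := by
    intro p n
    induction p using Finsupp.induction_linear with
    | zero => simp
    | add f g hf hg => simp [hf, hg]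
    | single m r =>
      rw [hG1, Polynomial.coeff_monomial, Finsupp.single_apply]
      split_ifs <;> simp
  let π : S →+ Polynomial (IsLocalRing.ResidueField R) := G.comp e.symm.toAddMonoidHom
  have hπE : ∀ p, π (E p) = G p := by
    intro p
    change G (e.symm (e p)) = G p
    rw [AddEquiv.symm_apply_apply]
  have hEsurj : ∀ s : S, ∃ p, E p = s := hEb.2
  have hπmul : ∀ a b : S, π (a * b) = π a * π b := by
    intro a b
    obtain ⟨p, rfl⟩ := hEsurj a
    obtain ⟨q, rfl⟩ := hEsurj b
    induction p using Finsupp.induction_linear with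
    | zero => simp
    | add f g hf hg => simp only [map_add, add_mul, hf, hg]
    | single n r =>
      induction q using Finsupp.induction_linear with
      | zero => simp
      | add f g hf hg => simp only [map_add, mul_add, hf, hg]
      | single m t =>
        have h : E (Finsupp.single n r) * E (Finsupp.single m t)
            = E (Finsupp.single (n + m) (r * (α ^ n) t)) := by
          rw [hE1, hE1, hE1, mul_assoc, ← mul_assoc (θ ^ n), hcomm, map_mul, pow_add]
          simp only [mul_assoc]
        rw [h, hπE, hπE, hπE, hG1, hG1, hG1, Polynomial.monomial_mul_monomial, map_mul, hαpow]
  have hπX : π (φ X) = 0 := by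
    have h : φ X = E (Finsupp.single 0 X) := by rw [hE1]; simp
    rw [h, hπE, hG1, (hR0 X).2 ⟨1, by simp⟩]; simp
  have hker : ∀ s : S, π s = 0 → ∃ s', s = φ X * s' := by
    intro s hs
    obtain ⟨p, rfl⟩ := hEsurj s
    rw [hπE] at hs
    have hm : E p ∈ (AddMonoidHom.mulLeft (φ X)).range := by
      rw [hEapp]
      refine AddSubgroup.sum_mem _ fun n _ => ?_
      obtain ⟨c, hc⟩ := (hR0 (p n)).1 (by rw [← hGc, hs]; simp)
      exact ⟨φ c * θ ^ n, by simp [hc, mul_assoc]⟩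
    obtain ⟨s', hs'⟩ := hm
    exact ⟨s', hs'.symm⟩
  have hnorm : ∀ s : S, ∃ s', φ X * s = s' * φ X := by
    intro s
    obtain ⟨p, rfl⟩ := hEsurj s
    induction p using Finsupp.induction_linear with
    | zero => exact ⟨0, by simp⟩
    | add f g hf hg =>
      obtain ⟨a, ha⟩ := hf
      obtain ⟨b, hb⟩ := hg
      exact ⟨a + b, by rw [map_add, mul_add, add_mul, ha, hb]⟩
    | single n r =>
      obtain ⟨c, hc⟩ := (hR0 _).1 (hαM (α ^ n).symm X ((hR0 X).2 ⟨1, by simp⟩))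
      have hc' : (α ^ n) (c * X) = X := by
        rw [mul_comm, ← hc, AlgEquiv.apply_symm_apply]
      refine ⟨φ r * θ ^ n * φ c, ?_⟩
      rw [hE1, mul_assoc _ (φ c), ← map_mul, mul_assoc (φ r), hcomm, hc', ← mul_assoc, ← mul_assoc,
        ← map_mul, ← map_mul, mul_comm]
  have hcancel : ∀ a b : S, a * φ X = b * φ X → a = b := by
    intro a b h
    apply hT.inj
    have := congrArg ψ h
    rw [map_mul, map_mul] at this
    exact hT.unit.mul_right_cancel this
  have hπz : π z ≠ 0 := fun h => hz (hker z h)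
  have key : ∀ (n : ℕ) (s s' : S), s * φ X ^ n = z * s' → ∃ w, s = z * w := by
    intro n
    induction n with
    | zero => intro s s' h; exact ⟨s', by simpa using h⟩
    | succ n ih =>
      intro s s' h
      have h1 : π z * π s' = 0 := by
        rw [← hπmul, ← h, pow_succ, ← mul_assoc, hπmul, hπX, mul_zero]
      obtain ⟨t, ht⟩ := hker s' ((mul_eq_zero.1 h1).resolve_left hπz)
      obtain ⟨t', ht'⟩ := hnorm t
      apply ih s t'
      apply hcancel
      rw [mul_assoc, ← pow_succ, h, ht, ht', mul_assoc]
  refine ⟨fun s => ⟨?_, ?_⟩, ?_⟩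
  · rintro ⟨t, ht⟩
    obtain ⟨s', n, hn⟩ := hT.surj t
    apply key n s s'
    apply hT.inj
    rw [map_mul, map_mul, map_pow, ht, mul_assoc, hn]
  · rintro ⟨s', rfl⟩
    exact ⟨ψ s', map_mul _ _ _⟩
  · intro m n
    obtain ⟨s, rfl⟩ := Submodule.Quotient.mk_surjective _ m
    intro h
    rw [← Submodule.Quotient.mk_smul, Submodule.Quotient.mk_eq_zero,
      Submodule.mem_span_singleton] at h
    obtain ⟨a, ha⟩ := h
    obtain ⟨w, hw⟩ := key n s a.unop (by simpa using ha.symm)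
    rw [Submodule.Quotient.mk_eq_zero, Submodule.mem_span_singleton]
    exact ⟨op w, by simp [hw]⟩
end

section
/- Let V be a faithful simple right S-module and U an unfaithful simple right S-module. Then Ext¹_S(U, V) = 0; equivalently, every extension of S-modules 0 → V → Y → U → 0 splits. -/
open MulOpposite

universe u

section Helpers

variable {R S : Type u} [CommRing R] [Ring S] {α : R ≃+* R} {φ : R →+* S} {θ : S}

theorem skew_induction (hS : IsSkewPolynomialRing α φ θ) (P : S → Prop)
    (h0 : P 0) (hadd : ∀ a b, P a → P b → P (a + b)) (hmul : ∀ a b, P a → P b → P (a * b))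
    (hφ : ∀ r, P (φ r)) (hθ : P θ) (s : S) : P s := by
  obtain ⟨p, rfl⟩ := hS.bijective.2 s
  have hpow : ∀ n : ℕ, P (θ ^ n) := by
    intro n
    induction n with
    | zero => rw [pow_zero, ← map_one φ]; exact hφ 1
    | succ n ih => rw [pow_succ]; exact hmul _ _ ih hθ
  exact Finset.sum_induction _ P hadd h0 (fun n _ => hmul _ _ (hφ _) (hpow n))

/-- `z` is a normal element. -/
def NormalElt (z : S) : Prop :=
  (∀ s, ∃ s', s * z = z * s') ∧ (∀ s, ∃ s', z * s = s' * z)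

theorem normal_of_gen (hS : IsSkewPolynomialRing α φ θ) (z : S)
    (h1 : ∀ r, ∃ s', φ r * z = z * s') (h2 : ∃ s', θ * z = z * s')
    (h3 : ∀ r, ∃ s', z * φ r = s' * z) (h4 : ∃ s', z * θ = s' * z) : NormalElt z := by
  constructor
  · refine skew_induction hS _ ⟨0, by simp⟩ ?_ ?_ h1 h2
    · rintro a b ⟨a', ha⟩ ⟨b', hb⟩
      exact ⟨a' + b', by rw [add_mul, mul_add, ha, hb]⟩
    · rintro a b ⟨a', ha⟩ ⟨b', hb⟩
      exact ⟨a' * b', by rw [mul_assoc, hb, ← mul_assoc, ha, mul_assoc]⟩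
  · refine skew_induction hS _ ⟨0, by simp⟩ ?_ ?_ h3 h4
    · rintro a b ⟨a', ha⟩ ⟨b', hb⟩
      exact ⟨a' + b', by rw [add_mul, mul_add, ha, hb]⟩
    · rintro a b ⟨a', ha⟩ ⟨b', hb⟩
      exact ⟨a' * b', by rw [← mul_assoc, ha, mul_assoc, hb, mul_assoc]⟩

theorem normal_theta (hS : IsSkewPolynomialRing α φ θ) : NormalElt θ := by
  refine normal_of_gen hS θ (fun r => ⟨φ (α.symm r), ?_⟩) ⟨θ, rfl⟩
    (fun r => ⟨φ (α r), hS.commutes r⟩) ⟨θ, rfl⟩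
  rw [hS.commutes, α.apply_symm_apply]

theorem normal_x (hS : IsSkewPolynomialRing α φ θ) (X : R) (h1 : X ∣ α X)
    (h2 : X ∣ α.symm X) : NormalElt (φ X) := by
  obtain ⟨q, hq⟩ := h1
  obtain ⟨t, ht⟩ := h2
  refine normal_of_gen hS _ (fun r => ⟨φ r, ?_⟩) ⟨φ q * θ, ?_⟩ (fun r => ⟨φ r, ?_⟩)
    ⟨θ * φ t, ?_⟩
  · rw [← map_mul, ← map_mul, mul_comm]
  · rw [hS.commutes, hq, map_mul, mul_assoc]
  · rw [← map_mul, ← map_mul, mul_comm]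
  · have := hS.commutes (α.symm X)
    rw [α.apply_symm_apply] at this
    rw [← this, ht, mul_comm X t, map_mul, mul_assoc]

theorem normal_surj {z : S} (hz : NormalElt z) (V : Type u) [AddCommGroup V] [Module Sᵐᵒᵖ V]
    [IsSimpleModule Sᵐᵒᵖ V] (hne : ∃ v : V, op z • v ≠ 0) (w : V) : ∃ v : V, op z • v = w := by
  let W : Submodule Sᵐᵒᵖ V :=
    { carrier := {w | ∃ v : V, op z • v = w}
      zero_mem' := ⟨0, smul_zero _⟩
      add_mem' := by
        rintro _ _ ⟨a, rfl⟩ ⟨b, rfl⟩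
        exact ⟨a + b, smul_add _ _ _⟩
      smul_mem' := by
        rintro c _ ⟨a, rfl⟩
        obtain ⟨s', hs'⟩ := hz.2 c.unop
        refine ⟨op s' • a, ?_⟩
        rw [smul_smul, smul_smul, ← op_mul, ← hs', op_mul, op_unop] }
  rcases eq_bot_or_eq_top W with h | h
  · obtain ⟨v, hv⟩ := hne
    have : op z • v ∈ W := ⟨v, rfl⟩
    rw [h, Submodule.mem_bot] at this
    exact absurd this hv
  · have : w ∈ W := by rw [h]; trivial
    exact this

theorem normal_inj {z : S} (hz : NormalElt z) (V : Type u) [AddCommGroup V] [Module Sᵐᵒᵖ V]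
    [IsSimpleModule Sᵐᵒᵖ V] (hne : ∃ v : V, op z • v ≠ 0) (w : V) (hw : op z • w = 0) :
    w = 0 := by
  let W : Submodule Sᵐᵒᵖ V :=
    { carrier := {w | op z • w = 0}
      zero_mem' := smul_zero _
      add_mem' := by
        intro a b ha hb
        simp only [Set.mem_setOf_eq] at *
        rw [smul_add, ha, hb, add_zero]
      smul_mem' := by
        intro c a ha
        simp only [Set.mem_setOf_eq] at *
        obtain ⟨s', hs'⟩ := hz.1 c.unop
        have : op z * c = op s' * op z := by
          rw [← op_mul, ← hs', op_mul, op_unop]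
        rw [smul_smul, this, mul_smul, ha, smul_zero] }
  rcases eq_bot_or_eq_top W with h | h
  · have : w ∈ W := hw
    rwa [h, Submodule.mem_bot] at this
  · obtain ⟨v, hv⟩ := hne
    have : v ∈ W := by rw [h]; trivial
    exact absurd this hv

theorem ext_of_normal {z : S} (hz : NormalElt z) (V U : Type u) [AddCommGroup V]
    [Module Sᵐᵒᵖ V] [IsSimpleModule Sᵐᵒᵖ V] [AddCommGroup U] [Module Sᵐᵒᵖ U]
    (hne : ∃ v : V, op z • v ≠ 0) (hU : ∀ u : U, op z • u = 0) : ExtVanish Sᵐᵒᵖ U V := by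
  intro Y _ _ i p hi _ hip
  have hex : ∀ y : Y, ∃ v : V, op z • i v = op z • y := by
    intro y
    have : op z • y ∈ LinearMap.range i := by
      rw [hip, LinearMap.mem_ker, map_smul, hU]
    obtain ⟨w, hw⟩ := this
    obtain ⟨v, rfl⟩ := normal_surj hz V hne w
    exact ⟨v, by rw [← hw, map_smul]⟩
  have huniq : ∀ v w : V, op z • i v = op z • i w → v = w := by
    intro v w h
    rw [← map_smul, ← map_smul] at h
    have h := hi h
    rw [← sub_eq_zero, ← smul_sub] at h
    exact sub_eq_zero.1 (normal_inj hz V hne _ h)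
  choose r hr using hex
  refine ⟨{ toFun := r, map_add' := ?_, map_smul' := ?_ }, ?_⟩
  · intro a b
    apply huniq
    rw [hr, map_add, smul_add, smul_add, hr, hr]
  · intro c a
    apply huniq
    obtain ⟨s', hs'⟩ := hz.1 c.unop
    have : op z * c = op s' * op z := by
      rw [← op_mul, ← hs', op_mul, op_unop]
    rw [hr, RingHom.id_apply, map_smul, smul_smul, smul_smul, this, mul_smul, mul_smul, hr]
  · ext v
    exact huniq _ _ (hr _)

theorem pow_comm_aux (hS : IsSkewPolynomialRing α φ θ) (n : ℕ) (r : R) :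
    θ ^ n * φ r = φ ((α ^ n) r) * θ ^ n := by
  induction n generalizing r with
  | zero => simp
  | succ n ih =>
    rw [pow_succ, mul_assoc, hS.commutes, ← mul_assoc, ih, mul_assoc, pow_succ]
    rfl

/-- A nonzero ideal contains a nonzero monomial. -/
theorem exists_monomial (hS : IsSkewPolynomialRing α φ θ) [IsDomain R]
    (hord : ∀ n : ℕ, 0 < n → α ^ n ≠ 1) (P : S → Prop)
    (hsub : ∀ a b, P a → P b → P (a - b)) (hl : ∀ a b, P b → P (a * b))
    (hr : ∀ a b, P a → P (a * b)) (hne : ∃ s, P s ∧ s ≠ 0) :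
    ∃ (a : R) (n : ℕ), a ≠ 0 ∧ P (φ a * θ ^ n) := by
  classical
  set E : (ℕ →₀ R) → S := fun p => p.sum fun n r => φ r * θ ^ n with hE
  have key : ∃ N : ℕ, ∃ p : ℕ →₀ R, p ≠ 0 ∧ P (E p) ∧ p.support.card = N := by
    obtain ⟨s, hs, hs0⟩ := hne
    obtain ⟨p, rfl⟩ := hS.bijective.2 s
    refine ⟨_, p, ?_, hs, rfl⟩
    rintro rfl
    exact hs0 (by simp)
  obtain ⟨p, hp0, hpP, hpc⟩ := Nat.find_spec key
  obtain ⟨n, hn⟩ := Finsupp.support_nonempty_iff.2 hp0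
  by_cases hsupp : ∀ m ∈ p.support, m = n
  · refine ⟨p n, n, Finsupp.mem_support_iff.1 hn, ?_⟩
    have : E p = φ (p n) * θ ^ n := by
      have h1 : p.support = {n} := Finset.eq_singleton_iff_unique_mem.2 ⟨hn, hsupp⟩
      simp only [hE, Finsupp.sum, h1, Finset.sum_singleton]
    rwa [← this]
  · exfalso
    push Not at hsupp
    obtain ⟨m, hm, hmn⟩ := hsupp
    have heq : ∀ r, (α ^ m) r = (α ^ n) r := by
      intro r
      let g : ℕ →₀ R := Finsupp.onFinset p.support
        (fun i => p i * ((α ^ i) r - (α ^ n) r)) (by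
          intro i hi
          rw [Finsupp.mem_support_iff]
          exact left_ne_zero_of_mul hi)
      have hg : ∀ i, g i = p i * ((α ^ i) r - (α ^ n) r) := fun i => rfl
      have hgsub : g.support ⊆ p.support := by
        intro i hi
        rw [Finsupp.mem_support_iff, hg] at hi
        rw [Finsupp.mem_support_iff]
        exact left_ne_zero_of_mul hi
      have hgE : E g = E p * φ r - φ ((α ^ n) r) * E p := by
        have h1 : E g = ∑ i ∈ p.support, φ (g i) * θ ^ i :=
          Finsupp.sum_of_support_subset _ hgsub _ (by simp)
        rw [h1]
        simp only [hE, Finsupp.sum]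
        rw [Finset.sum_mul, Finset.mul_sum, ← Finset.sum_sub_distrib]
        refine Finset.sum_congr rfl fun i _ => ?_
        rw [hg, mul_assoc, pow_comm_aux hS, ← mul_assoc, ← mul_assoc, ← sub_mul, ← map_mul,
          ← map_mul, ← map_sub, mul_sub, mul_comm (p i) ((α ^ n) r)]
      have hgP : P (E g) := by
        rw [hgE]; exact hsub _ _ (hr _ _ hpP) (hl _ _ hpP)
      have hg0 : g = 0 := by
        by_contra hg0
        have hlt : g.support.card < Nat.find key := by
          rw [← hpc]
          refine Finset.card_lt_card ⟨hgsub, fun h => ?_⟩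
          have := h hn
          rw [Finsupp.mem_support_iff, hg, sub_self, mul_zero] at this
          exact this rfl
        exact Nat.find_min key hlt ⟨g, hg0, hgP, rfl⟩
      have h2 : g m = 0 := by rw [hg0]; rfl
      rw [hg] at h2
      rcases mul_eq_zero.1 h2 with h | h
      · exact absurd h (Finsupp.mem_support_iff.1 hm)
      · exact sub_eq_zero.1 h
    have heq' : α ^ m = α ^ n := RingEquiv.ext heq
    rcases lt_or_gt_of_ne hmn with h | h
    · refine hord (n - m) (by omega) ?_
      have h3 : α ^ m * α ^ (n - m) = α ^ m * 1 := by
        rw [← pow_add, mul_one, heq']; congr 1; omega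
      exact mul_left_cancel h3
    · refine hord (m - n) (by omega) ?_
      have h3 : α ^ n * α ^ (m - n) = α ^ n * 1 := by
        rw [← pow_add, mul_one, ← heq']; congr 1; omega
      exact mul_left_cancel h3

end Helpers

/-- Let `V` be a faithful simple right `S`-module and `U` an
unfaithful simple right `S`-module.  Then `Ext¹_S(U, V) = 0`; equivalently, every
extension of `S`-modules `0 → V → Y → U → 0` splits. -/
theorem ext_vanishes_unfaithful_by_faithful
    {k : Type u} [Field k]
    {R : Type u} [CommRing R] [IsDomain R] [IsDiscreteValuationRing R] [Algebra k R]
    (X : R) (hX : IsLocalRing.maximalIdeal R = Ideal.span {X})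
    (hres : Function.Bijective ((IsLocalRing.residue R).comp (algebraMap k R)))
    (α : R ≃ₐ[k] R) (hord : ∀ n : ℕ, 0 < n → α ^ n ≠ 1)
    {S : Type u} [Ring S] (φ : R →+* S) (θ : S)
    (hS : IsSkewPolynomialRing α.toRingEquiv φ θ)
    {T : Type u} [Ring T] (ψ : S →+* T) (hT : IsLocalizationAt (φ X) ψ)
    (V U : Type u) [AddCommGroup V] [Module Sᵐᵒᵖ V] [AddCommGroup U] [Module Sᵐᵒᵖ U]
    (hV : IsSimpleModule Sᵐᵒᵖ V) (hVf : FaithfulSMul Sᵐᵒᵖ V)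
    (hU : IsSimpleModule Sᵐᵒᵖ U) (hUf : ¬ FaithfulSMul Sᵐᵒᵖ U) :
    ExtVanish Sᵐᵒᵖ U V := by
  have hXirr : Irreducible X := (IsDiscreteValuationRing.irreducible_iff_uniformizer X).2 hX
  have hdvd : ∀ β : R ≃+* R, X ∣ β X := by
    intro β
    rw [← Ideal.mem_span_singleton, ← hX, IsLocalRing.mem_maximalIdeal, mem_nonunits_iff]
    intro h
    exact hXirr.not_isUnit ((MulEquiv.isUnit_map β).1 h)
  have hnx : NormalElt (φ X) := normal_x hS X (hdvd _) (hdvd _)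
  have hnt : NormalElt θ := normal_theta hS
  have hone : ∀ (n : ℕ) (a : R), a ≠ 0 → φ a * θ ^ n ≠ 0 := by
    intro n a ha h
    have h1 : Finsupp.single n a = (0 : ℕ →₀ R) := by
      apply hS.bijective.1
      simp [Finsupp.sum_single_index, h]
    exact ha (Finsupp.single_eq_zero.1 h1)
  have hx0 : φ X ≠ 0 := by simpa using hone 0 X hXirr.ne_zero
  have ht0 : θ ≠ 0 := by simpa using hone 1 1 one_ne_zero
  have hVne : ∀ z : S, z ≠ 0 → ∃ v : V, op z • v ≠ 0 := by
    intro z hz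
    by_contra! h
    have : op z = 0 := hVf.eq_of_smul_eq_smul (α := V) (fun v => by rw [h v, zero_smul])
    exact hz (op_injective this)
  by_cases hxU : ∃ u : U, op (φ X) • u ≠ 0
  swap
  · push Not at hxU
    exact ext_of_normal hnx V U (hVne _ hx0) hxU
  by_cases htU : ∃ u : U, op θ • u ≠ 0
  swap
  · push Not at htU
    exact ext_of_normal hnt V U (hVne _ ht0) htU
  exfalso
  have hord' : ∀ n : ℕ, 0 < n → α.toRingEquiv ^ n ≠ 1 := by
    intro n hn h
    apply hord n hn
    have hp : ∀ (m : ℕ) (r : R), (α ^ m) r = (α.toRingEquiv ^ m) r := by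
      intro m
      induction m with
      | zero => intro r; rfl
      | succ m ih => intro r; rw [pow_succ, pow_succ]; exact ih _
    ext r
    rw [hp, h]
    rfl
  have hann : ∃ s : S, (∀ u : U, op s • u = 0) ∧ s ≠ 0 := by
    by_contra! h
    apply hUf
    refine ⟨fun {a b} hab => ?_⟩
    have : unop (a - b) = 0 := h _ (fun u => by rw [op_unop, sub_smul, hab u, sub_self])
    exact sub_eq_zero.1 (unop_injective this)
  obtain ⟨a, n, ha, han⟩ := exists_monomial hS hord' (fun s => ∀ u : U, op s • u = 0)
    (fun a b h1 h2 u => by rw [op_sub, sub_smul, h1, h2, sub_self])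
    (fun a b h u => by rw [op_mul, mul_smul, h])
    (fun a b h u => by rw [op_mul, mul_smul, h, smul_zero]) hann
  obtain ⟨m, e, rfl⟩ := IsDiscreteValuationRing.eq_unit_mul_pow_irreducible ha hXirr
  have hinj : ∀ z : S, (∀ u : U, op z • u = 0 → u = 0) →
      ∀ (j : ℕ) (u : U), op (z ^ j) • u = 0 → u = 0 := by
    intro z hz j
    induction j with
    | zero => intro u hu; simpa using hu
    | succ j ih =>
      intro u hu
      rw [pow_succ, op_mul, mul_smul] at hu
      exact ih u (hz _ hu)
  obtain ⟨u, hu⟩ := hxU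
  have hu0 : u ≠ 0 := by rintro rfl; exact hu (smul_zero _)
  have h1 := hinj θ (normal_inj hnt U htU) n _ (by
    have := han u
    rwa [op_mul, mul_smul] at this)
  rw [map_mul, map_pow, op_mul, mul_smul] at h1
  have h2 := hinj _ (normal_inj hnx U ⟨u, hu⟩) m _ h1
  apply hu0
  have h3 : op (φ ((e⁻¹ : Rˣ) : R)) • op (φ (e : R)) • u = 0 := by rw [h2, smul_zero]
  rwa [smul_smul, ← op_mul, ← map_mul, Units.mul_inv, map_one, op_one, one_smul] at h3
end

section
/- Let V be a faithful simple right S-module and let 𝒞 := {1 + Xs : s ∈ S}. Then: (1) 𝒞 is an α-invariant Ore set in S; (2) the set W of 𝒞-torsion elements of E_T(V) is a nonzero T-submodule of E_T(V); (3) if c ∈ 𝒞 and c = c₁⋯c_t is a factorization of c into irreducible elements of S, then each c_i has type (B); (4) as an S-module, W is locally Artinian, and all composition factors of its finitely generated submodules are type (B) (i.e. faithful) simple modules. -/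
open MulOpposite

universe u

/-- Coefficient data on the skew polynomial ring. -/
structure SkewCoeff {R S : Type u} [CommRing R] [Ring S] (α : R ≃+* R) (φ : R →+* S) where
  P : S ≃+ Polynomial R
  mul : ∀ s t n, (P (s * t)).coeff n =
    ∑ x ∈ Finset.HasAntidiagonal.antidiagonal n, (P s).coeff x.1 * (α ^ x.1) ((P t).coeff x.2)
  phi : ∀ r, P (φ r) = Polynomial.C r

namespace SkewCoeff

section basics
variable {R S : Type u} [CommRing R] [Ring S] {α : R ≃+* R} {φ : R →+* S} {θ : S}

theorem pow_comm (h : IsSkewPolynomialRing α φ θ) (n : ℕ) (r : R) :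
    θ ^ n * φ r = φ ((α ^ n) r) * θ ^ n := by
  induction n generalizing r with
  | zero => simp
  | succ n ih =>
    rw [pow_succ, mul_assoc, h.commutes, ← mul_assoc, ih, mul_assoc]
    rw [pow_succ α]; rfl

/-- The evaluation map as an additive equivalence. -/
noncomputable def evalEquiv (h : IsSkewPolynomialRing α φ θ) : (ℕ →₀ R) ≃+ S :=
  AddEquiv.ofBijective
    ({ toFun := fun p : ℕ →₀ R => p.sum fun n r => φ r * θ ^ n
       map_zero' := by simp
       map_add' := fun p q => by
        apply Finsupp.sum_add_index' <;> simp [add_mul] } : (ℕ →₀ R) →+ S) h.bijective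

theorem evalEquiv_single (h : IsSkewPolynomialRing α φ θ) (n : ℕ) (r : R) :
    evalEquiv h (Finsupp.single n r) = φ r * θ ^ n := by
  change (Finsupp.single n r).sum (fun n r => φ r * θ ^ n) = _
  simp

/-- Coefficients in the polynomial ring. -/
noncomputable def equivP (h : IsSkewPolynomialRing α φ θ) : S ≃+ Polynomial R :=
  (evalEquiv h).symm.trans
    ((Polynomial.toFinsuppIso R).toAddEquiv.trans
      (AddMonoidAlgebra.coeffAddEquiv)).symm

theorem equivP_monomial (h : IsSkewPolynomialRing α φ θ) (n : ℕ) (r : R) :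
    equivP h (φ r * θ ^ n) = Polynomial.monomial n r := by
  rw [← evalEquiv_single h]
  simp [equivP]

theorem equivP_mul (h : IsSkewPolynomialRing α φ θ) (s t : S) (n : ℕ) :
    (equivP h (s * t)).coeff n =
    ∑ x ∈ Finset.HasAntidiagonal.antidiagonal n, (equivP h s).coeff x.1 * (α ^ x.1) ((equivP h t).coeff x.2) := by
  obtain ⟨p, rfl⟩ := (equivP h).symm.surjective s
  obtain ⟨q, rfl⟩ := (equivP h).symm.surjective t
  simp only [AddEquiv.apply_symm_apply]
  induction p using Polynomial.induction_on' with
  | add p p' hp hp' =>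
    simp only [map_add, add_mul, Polynomial.coeff_add, hp, hp', Finset.sum_add_distrib]
  | monomial i a =>
    induction q using Polynomial.induction_on' with
    | add p p' hp hp' =>
      simp only [map_add, mul_add, Polynomial.coeff_add, hp, hp', Finset.sum_add_distrib]
    | monomial j b =>
      rw [← equivP_monomial h, ← equivP_monomial h, AddEquiv.symm_apply_apply,
        AddEquiv.symm_apply_apply]
      have : φ a * θ ^ i * (φ b * θ ^ j) = φ (a * (α ^ i) b) * θ ^ (i + j) := by
        rw [mul_assoc, ← mul_assoc (θ ^ i), pow_comm h, map_mul, pow_add]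
        simp only [mul_assoc]
      rw [this, equivP_monomial, equivP_monomial, equivP_monomial, Polynomial.coeff_monomial]
      split_ifs with hn
      · subst hn
        rw [Finset.sum_eq_single (i, j)]
        · simp
        · rintro ⟨x, y⟩ hxy hne
          simp only [Polynomial.coeff_monomial]
          split_ifs with h1 h2
          · simp_all
          · simp
          · simp
          · simp
        · simp
      · symm
        apply Finset.sum_eq_zero
        rintro ⟨x, y⟩ hxy
        simp only [Polynomial.coeff_monomial]
        simp only [Finset.HasAntidiagonal.mem_antidiagonal] at hxy
        split_ifs with h1 h2
        · omega
        all_goals simp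

/-- The coefficient data attached to a skew polynomial ring. -/
noncomputable def ofSkew (h : IsSkewPolynomialRing α φ θ) : SkewCoeff α φ where
  P := equivP h
  mul := equivP_mul h
  phi r := by
    have := equivP_monomial h 0 r
    simpa using this

/-- Twist the coefficients of a polynomial by powers of an automorphism. -/
noncomputable def twist (α : R ≃+* R) (p : Polynomial R) : Polynomial R :=
  ∑ i ∈ p.support, Polynomial.monomial i ((α ^ i) (p.coeff i))

theorem coeff_twist (α : R ≃+* R) (p : Polynomial R) (n : ℕ) :
    (twist α p).coeff n = (α ^ n) (p.coeff n) := by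
  simp only [twist, Polynomial.finsetSum_coeff, Polynomial.coeff_monomial]
  rw [Finset.sum_ite_eq']
  split_ifs with h
  · rfl
  · rw [Polynomial.notMem_support_iff.mp h, map_zero]

theorem symm_pow_apply (α : R ≃+* R) (n : ℕ) (r : R) : (α.symm ^ n) ((α ^ n) r) = r := by
  have : (α⁻¹ ^ n * α ^ n) r = r := by simp
  exact this

theorem symm_pow_apply' (α : R ≃+* R) (n : ℕ) (r : R) : (α ^ n) ((α.symm ^ n) r) = r := by
  have : (α ^ n * α⁻¹ ^ n) r = r := by simp
  exact this

/-- The map `R → Sᵐᵒᵖ`. -/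
def opHom (φ : R →+* S) : R →+* Sᵐᵒᵖ where
  toFun r := op (φ r)
  map_one' := by simp
  map_zero' := by simp
  map_mul' x y := by rw [mul_comm x y, map_mul, op_mul]
  map_add' x y := by rw [map_add, op_add]

/-- The opposite coefficient data. -/
noncomputable def opp (D : SkewCoeff α φ) : SkewCoeff α.symm (opHom φ) where
  P :=
    { toFun := fun s => twist α.symm (D.P (unop s))
      invFun := fun p => op (D.P.symm (twist α p))
      left_inv := fun s => by
        apply unop_injective
        apply D.P.injective
        ext n
        rw [unop_op, AddEquiv.apply_symm_apply, coeff_twist, coeff_twist, symm_pow_apply']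
      right_inv := fun p => by
        ext n
        beta_reduce
        rw [unop_op, AddEquiv.apply_symm_apply, coeff_twist, coeff_twist, symm_pow_apply]
      map_add' := fun s t => by
        ext n
        simp [coeff_twist] }
  mul s t n := by
    simp only [AddEquiv.coe_mk, Equiv.coe_fn_mk, coeff_twist, unop_mul, D.mul, map_sum, map_mul]
    rw [← Finset.Nat.sum_antidiagonal_swap]
    apply Finset.sum_congr rfl
    rintro ⟨i, j⟩ hij
    simp only [Finset.HasAntidiagonal.mem_antidiagonal] at hij
    subst hij
    simp only [Prod.swap]
    have h1 : (α.symm ^ (i + j)) ((α ^ j) ((D.P (unop s)).coeff i)) =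
        (α.symm ^ i) ((D.P (unop s)).coeff i) := by
      rw [pow_add]
      change (α.symm ^ i) ((α.symm ^ j) _) = _
      rw [symm_pow_apply]
    rw [h1, pow_add]
    change (α.symm ^ i) ((α.symm ^ j) _) * _ = _
    rw [mul_comm]
  phi r := by
    ext n
    simp only [AddEquiv.coe_mk, Equiv.coe_fn_mk, coeff_twist, opHom, RingHom.coe_mk,
      MonoidHom.coe_mk, OneHom.coe_mk, unop_op, D.phi, Polynomial.coeff_C]
    split_ifs with h
    · subst h; simp
    · simp

theorem P_one (D : SkewCoeff α φ) : D.P 1 = 1 := by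
  rw [← map_one φ, D.phi, map_one]

theorem coeff_phi_mul (D : SkewCoeff α φ) (r : R) (s : S) (n : ℕ) :
    (D.P (φ r * s)).coeff n = r * (D.P s).coeff n := by
  rw [D.mul, Finset.sum_eq_single (0, n)]
  · simp [D.phi]
  · rintro ⟨x, y⟩ hxy hne
    simp only [Finset.HasAntidiagonal.mem_antidiagonal] at hxy
    simp only [D.phi, Polynomial.coeff_C]
    split_ifs with h
    · subst h; simp at hxy; simp_all
    · simp
  · simp

theorem coeff_mul_phi (D : SkewCoeff α φ) (r : R) (s : S) (n : ℕ) :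
    (D.P (s * φ r)).coeff n = (D.P s).coeff n * (α ^ n) r := by
  rw [D.mul, Finset.sum_eq_single (n, 0)]
  · simp [D.phi]
  · rintro ⟨x, y⟩ hxy hne
    simp only [Finset.HasAntidiagonal.mem_antidiagonal] at hxy
    simp only [D.phi, Polynomial.coeff_C]
    split_ifs with h
    · subst h; simp at hxy; simp_all
    · simp
  · simp

theorem coeff_mul_top (D : SkewCoeff α φ) (s t : S) (m l : ℕ) (hs : (D.P s).natDegree ≤ m)
    (ht : (D.P t).natDegree ≤ l) :
    (D.P (s * t)).coeff (m + l) = (D.P s).coeff m * (α ^ m) ((D.P t).coeff l) := by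
  rw [D.mul, Finset.sum_eq_single (m, l)]
  · rintro ⟨x, y⟩ hxy hne
    simp only [Finset.HasAntidiagonal.mem_antidiagonal] at hxy
    simp only
    rcases lt_trichotomy m x with h | h | h
    · rw [Polynomial.coeff_eq_zero_of_natDegree_lt (lt_of_le_of_lt hs h), zero_mul]
    · subst h; simp at hxy; simp_all
    · rw [Polynomial.coeff_eq_zero_of_natDegree_lt (p := D.P t) (by omega), map_zero, mul_zero]
  · simp

theorem natDegree_mul_le (D : SkewCoeff α φ) (s t : S) :
    (D.P (s * t)).natDegree ≤ (D.P s).natDegree + (D.P t).natDegree := by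
  rw [Polynomial.natDegree_le_iff_coeff_eq_zero]
  intro N hN
  rw [D.mul]
  apply Finset.sum_eq_zero
  rintro ⟨x, y⟩ hxy
  simp only [Finset.HasAntidiagonal.mem_antidiagonal] at hxy
  simp only
  rcases lt_or_ge (D.P s).natDegree x with h | h
  · rw [Polynomial.coeff_eq_zero_of_natDegree_lt h, zero_mul]
  · rw [Polynomial.coeff_eq_zero_of_natDegree_lt (p := D.P t) (by omega), map_zero, mul_zero]

theorem P_ne_zero (D : SkewCoeff α φ) {s : S} (hs : s ≠ 0) : D.P s ≠ 0 := by
  simpa using hs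

section dom
variable [IsDomain R]

theorem lead_ne (D : SkewCoeff α φ) {s t : S} (hs : s ≠ 0) (ht : t ≠ 0) :
    (D.P (s * t)).coeff ((D.P s).natDegree + (D.P t).natDegree) ≠ 0 := by
  rw [D.coeff_mul_top s t _ _ le_rfl le_rfl]
  apply mul_ne_zero
  · exact Polynomial.leadingCoeff_ne_zero.mpr (D.P_ne_zero hs)
  · rw [Ne, EmbeddingLike.map_eq_zero_iff]
    exact Polynomial.leadingCoeff_ne_zero.mpr (D.P_ne_zero ht)

theorem mul_ne (D : SkewCoeff α φ) {s t : S} (hs : s ≠ 0) (ht : t ≠ 0) : s * t ≠ 0 := by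
  intro h
  apply D.lead_ne hs ht
  simp [h]

theorem noZeroDivisors (D : SkewCoeff α φ) : NoZeroDivisors S where
  eq_zero_or_eq_zero_of_mul_eq_zero := by
    intro a b hab
    by_contra! hh
    exact D.mul_ne hh.1 hh.2 hab

theorem nontriv (D : SkewCoeff α φ) : Nontrivial S :=
  D.P.toEquiv.nontrivial

theorem natDegree_mul (D : SkewCoeff α φ) {s t : S} (hs : s ≠ 0) (ht : t ≠ 0) :
    (D.P (s * t)).natDegree = (D.P s).natDegree + (D.P t).natDegree :=
  le_antisymm (D.natDegree_mul_le s t) (Polynomial.le_natDegree_of_ne_zero (D.lead_ne hs ht))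

theorem isUnit_of_right (D : SkewCoeff α φ) {a b : S} (h : a * b = 1) : IsUnit a := by
  have := D.noZeroDivisors
  have := D.nontriv
  have hb : b ≠ 0 := by rintro rfl; simp at h
  have : (b * a - 1) * b = 0 := by rw [sub_mul, mul_assoc, h]; simp
  have h2 : b * a = 1 := by
    rcases mul_eq_zero.mp this with h' | h'
    · exact sub_eq_zero.mp h'
    · exact absurd h' hb
  exact ⟨⟨a, b, h, h2⟩, rfl⟩

end dom

section loc
variable [IsLocalRing R]

open IsLocalRing

theorem residue_pow (hα : ∀ r, residue R (α r) = residue R r) (n : ℕ) (r : R) :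
    residue R ((α ^ n) r) = residue R r := by
  induction n generalizing r with
  | zero => simp
  | succ n ih => rw [pow_succ, RingAut.mul_apply, ih, hα]

/-- Reduction modulo `X`. -/
noncomputable def red (D : SkewCoeff α φ) (hα : ∀ r, residue R (α r) = residue R r) :
    S →+* Polynomial (ResidueField R) where
  toFun s := (D.P s).map (residue R)
  map_one' := by rw [P_one]; simp
  map_zero' := by simp
  map_add' s t := by simp
  map_mul' s t := by
    ext n
    rw [Polynomial.coeff_map, D.mul, Polynomial.coeff_mul, map_sum]
    apply Finset.sum_congr rfl
    intro x hx
    rw [map_mul, residue_pow hα, Polynomial.coeff_map, Polynomial.coeff_map]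

theorem red_apply (D : SkewCoeff α φ) (hα : ∀ r, residue R (α r) = residue R r) (s : S) :
    D.red hα s = (D.P s).map (residue R) := rfl

theorem red_phi (D : SkewCoeff α φ) (hα : ∀ r, residue R (α r) = residue R r) (r : R) :
    D.red hα (φ r) = Polynomial.C (residue R r) := by
  rw [red_apply, D.phi, Polynomial.map_C]

theorem red_eq_zero (D : SkewCoeff α φ) (hα : ∀ r, residue R (α r) = residue R r) (s : S) :
    D.red hα s = 0 ↔ ∀ n, (D.P s).coeff n ∈ maximalIdeal R := by
  rw [red_apply, Polynomial.ext_iff]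
  simp [Polynomial.coeff_map, residue_eq_zero_iff]

variable {X : R}

theorem red_X (hX : maximalIdeal R = Ideal.span {X}) (D : SkewCoeff α φ) (hα : ∀ r, residue R (α r) = residue R r) :
    D.red hα (φ X) = 0 := by
  rw [red_phi]
  have : X ∈ maximalIdeal R := by rw [hX]; exact Ideal.mem_span_singleton_self X
  rw [(residue_eq_zero_iff X).mpr this, map_zero]

/-- Polynomial with prescribed coefficients. -/
theorem exists_poly (p : Polynomial R) (f : ℕ → R) (hf : ∀ n, p.coeff n = 0 → f n = 0) :
    ∃ q : Polynomial R, ∀ n, q.coeff n = f n := by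
  refine ⟨∑ i ∈ p.support, Polynomial.monomial i (f i), fun n => ?_⟩
  simp only [Polynomial.finsetSum_coeff, Polynomial.coeff_monomial]
  rw [Finset.sum_ite_eq']
  split_ifs with h
  · rfl
  · rw [hf n (Polynomial.notMem_support_iff.mp h)]

theorem exists_left (hX : maximalIdeal R = Ideal.span {X}) (D : SkewCoeff α φ) (hα : ∀ r, residue R (α r) = residue R r) {s : S}
    (hs : D.red hα s = 0) : ∃ t, s = φ X * t := by
  rw [red_eq_zero] at hs
  have : ∀ n, ∃ r, (D.P s).coeff n = X * r ∧ ((D.P s).coeff n = 0 → r = 0) := by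
    intro n
    by_cases h0 : (D.P s).coeff n = 0
    · exact ⟨0, by simp [h0]⟩
    · have := hs n
      rw [hX, Ideal.mem_span_singleton] at this
      obtain ⟨r, hr⟩ := this
      exact ⟨r, hr, fun h => absurd h h0⟩
  choose f hf hf0 using this
  obtain ⟨q, hq⟩ := exists_poly (D.P s) f hf0
  refine ⟨D.P.symm q, ?_⟩
  apply D.P.injective
  ext n
  rw [D.coeff_phi_mul, AddEquiv.apply_symm_apply, hq, hf]

theorem pow_X_dvd (hX : maximalIdeal R = Ideal.span {X}) (hα : ∀ r, residue R (α r) = residue R r) (n : ℕ) :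
    ∀ r ∈ maximalIdeal R, (α ^ n) X ∣ r := by
  intro r hr
  have h1 : (α.symm ^ n) r ∈ maximalIdeal R := by
    rw [← residue_eq_zero_iff, ← residue_pow hα n, symm_pow_apply', residue_eq_zero_iff]
    exact hr
  rw [hX, Ideal.mem_span_singleton] at h1
  have := map_dvd (α ^ n) h1
  rwa [symm_pow_apply'] at this

theorem exists_right (hX : maximalIdeal R = Ideal.span {X}) (D : SkewCoeff α φ) (hα : ∀ r, residue R (α r) = residue R r) {s : S}
    (hs : D.red hα s = 0) : ∃ t, s = t * φ X := by
  rw [red_eq_zero] at hs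
  have : ∀ n, ∃ r, (D.P s).coeff n = r * (α ^ n) X ∧ ((D.P s).coeff n = 0 → r = 0) := by
    intro n
    by_cases h0 : (D.P s).coeff n = 0
    · exact ⟨0, by simp [h0]⟩
    · obtain ⟨r, hr⟩ := pow_X_dvd hX hα n _ (hs n)
      exact ⟨r, by rw [hr, mul_comm], fun h => absurd h h0⟩
  choose f hf hf0 using this
  obtain ⟨q, hq⟩ := exists_poly (D.P s) f hf0
  refine ⟨D.P.symm q, ?_⟩
  apply D.P.injective
  ext n
  rw [D.coeff_mul_phi, AddEquiv.apply_symm_apply, hq, hf]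

theorem X_comm (hX : maximalIdeal R = Ideal.span {X}) (D : SkewCoeff α φ) (hα : ∀ r, residue R (α r) = residue R r) (s : S) :
    ∃ t, φ X * s = t * φ X :=
  D.exists_right hX hα (by rw [map_mul, D.red_X hX, zero_mul])

theorem X_comm' (hX : maximalIdeal R = Ideal.span {X}) (D : SkewCoeff α φ) (hα : ∀ r, residue R (α r) = residue R r) (s : S) :
    ∃ t, s * φ X = φ X * t :=
  D.exists_left hX hα (by rw [map_mul, D.red_X hX, mul_zero])

theorem red_eq_one (hX : maximalIdeal R = Ideal.span {X}) (D : SkewCoeff α φ) (hα : ∀ r, residue R (α r) = residue R r) (c : S) :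
    D.red hα c = 1 ↔ ∃ s, c = 1 + φ X * s := by
  constructor
  · intro h
    obtain ⟨t, ht⟩ := D.exists_left hX hα (s := c - 1) (by rw [map_sub, h, map_one, sub_self])
    exact ⟨t, by rw [← ht]; abel⟩
  · rintro ⟨s, rfl⟩
    rw [map_add, map_mul, D.red_X hX]; simp

end loc

end basics
end SkewCoeff

namespace SkewCoeff
section main
open IsLocalRing
variable {R S : Type u} [CommRing R] [IsDomain R] [IsDiscreteValuationRing R] [Ring S]
  {α : R ≃+* R} {φ : R →+* S} {X : R}

theorem X_ne_zero (hX : maximalIdeal R = Ideal.span {X}) : X ≠ 0 :=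
  ((IsDiscreteValuationRing.irreducible_iff_uniformizer X).mpr hX).ne_zero

theorem phiX_ne (D : SkewCoeff α φ) (hX : maximalIdeal R = Ideal.span {X}) : φ X ≠ 0 := by
  intro h
  have h1 := D.phi X
  rw [h, map_zero] at h1
  exact X_ne_zero hX (Polynomial.C_eq_zero.mp h1.symm)

theorem primitive (D : SkewCoeff α φ) (hX : maximalIdeal R = Ideal.span {X})
    (hα : ∀ r, residue R (α r) = residue R r) (s : S) (hs : s ≠ 0) :
    ∃ (n : ℕ) (s' : S), s = s' * φ X ^ n ∧ D.red hα s' ≠ 0 := by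
  have key : ∀ (N : ℕ) (s : S), (∃ n, ¬ X ^ N ∣ (D.P s).coeff n) →
      ∃ (n : ℕ) (s' : S), s = s' * φ X ^ n ∧ D.red hα s' ≠ 0 := by
    intro N
    induction N with
    | zero => rintro s ⟨n, hn⟩; simp at hn
    | succ N ih =>
      rintro s ⟨n, hn⟩
      by_cases h : D.red hα s = 0
      · obtain ⟨t, rfl⟩ := D.exists_right hX hα h
        have : ∃ n, ¬ X ^ N ∣ (D.P t).coeff n := by
          refine ⟨n, fun hd => hn ?_⟩
          rw [D.coeff_mul_phi, pow_succ]
          apply mul_dvd_mul hd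
          rw [← Ideal.mem_span_singleton, ← hX, ← residue_eq_zero_iff, residue_pow hα,
            residue_eq_zero_iff, hX]
          exact Ideal.mem_span_singleton_self X
        obtain ⟨m, s', h1, h2⟩ := ih t this
        exact ⟨m + 1, s', by rw [h1, pow_succ, mul_assoc], h2⟩
      · exact ⟨0, s, by simp, h⟩
  have hl : (D.P s).coeff (D.P s).natDegree ≠ 0 :=
    Polynomial.leadingCoeff_ne_zero.mpr (D.P_ne_zero hs)
  have hirr := (IsDiscreteValuationRing.irreducible_iff_uniformizer X).mpr hX
  obtain ⟨N, hN⟩ := FiniteMultiplicity.of_not_isUnit hirr.not_isUnit hl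
  exact key (N + 1) s ⟨_, hN⟩

theorem cancelX (D : SkewCoeff α φ) (hX : maximalIdeal R = Ideal.span {X})
    (hα : ∀ r, residue R (α r) = residue R r) {b : S} (hb : D.red hα b ≠ 0) (i : ℕ) (a y : S)
    (h : a * φ X ^ i = b * y) : ∃ y', a = b * y' := by
  induction i generalizing y with
  | zero => exact ⟨y, by simpa using h⟩
  | succ i ih =>
    have h1 : D.red hα b * D.red hα y = 0 := by
      rw [← map_mul, ← h, pow_succ, ← mul_assoc, map_mul, D.red_X hX, mul_zero]
    obtain ⟨y', rfl⟩ := D.exists_right hX hα ((mul_eq_zero.mp h1).resolve_left hb)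
    apply ih y'
    have := D.noZeroDivisors
    have := D.nontriv
    have : IsDomain S := NoZeroDivisors.to_isDomain S
    apply mul_right_cancel₀ (D.phiX_ne hX)
    rw [mul_assoc, ← pow_succ, h, mul_assoc]

theorem pow_comm' (D : SkewCoeff α φ) (hX : maximalIdeal R = Ideal.span {X})
    (hα : ∀ r, residue R (α r) = residue R r) (n : ℕ) (s : S) :
    ∃ t, s * φ X ^ n = φ X ^ n * t := by
  induction n with
  | zero => exact ⟨s, by simp⟩
  | succ n ih =>
    obtain ⟨t, ht⟩ := ih
    obtain ⟨t', ht'⟩ := D.X_comm' hX hα t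
    exact ⟨t', by rw [pow_succ, ← mul_assoc, ht, mul_assoc, ht', mul_assoc]⟩

/-- The `X`-saturation of a right ideal. -/
def sat (D : SkewCoeff α φ) (hX : maximalIdeal R = Ideal.span {X})
    (hα : ∀ r, residue R (α r) = residue R r) (J : Submodule Sᵐᵒᵖ S) : Submodule Sᵐᵒᵖ S where
  carrier := {a | ∃ i, a * φ X ^ i ∈ J}
  zero_mem' := ⟨0, by simp⟩
  add_mem' := by
    rintro a b ⟨i, hi⟩ ⟨j, hj⟩
    refine ⟨i + j, ?_⟩
    rw [add_mul]
    apply J.add_mem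
    · rw [pow_add, ← mul_assoc]
      exact J.smul_mem (op (φ X ^ j)) hi
    · rw [add_comm i j, pow_add, ← mul_assoc]
      exact J.smul_mem (op (φ X ^ i)) hj
  smul_mem' := by
    rintro s a ⟨i, hi⟩
    obtain ⟨t, ht⟩ := D.pow_comm' hX hα i (unop s)
    refine ⟨i, ?_⟩
    have : s • a * φ X ^ i = op t • (a * φ X ^ i) := by
      change a * unop s * _ = _ * t
      rw [mul_assoc, ht, mul_assoc]
    rw [this]
    exact J.smul_mem _ hi

theorem mul_mem_right {J : Submodule Sᵐᵒᵖ S} {a : S} (ha : a ∈ J) (s : S) : a * s ∈ J :=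
  J.smul_mem (op s) ha

theorem natDegree_phi (D : SkewCoeff α φ) (r : R) : (D.P (φ r)).natDegree = 0 := by
  rw [D.phi]; simp

theorem division (D : SkewCoeff α φ) (hX : maximalIdeal R = Ideal.span {X})
    (hα : ∀ r, residue R (α r) = residue R r) (K : Submodule Sᵐᵒᵖ S) (b : S) (hb : b ∈ K)
    (hb0 : b ≠ 0) (hmin : ∀ a ∈ K, a ≠ 0 → (D.P b).natDegree ≤ (D.P a).natDegree)
    (a : S) (ha : a ∈ K) : ∃ (i : ℕ) (y : S), a * φ X ^ i = b * y := by
  induction hn : (D.P a).natDegree using Nat.strong_induction_on generalizing a with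
  | _ n ih =>
  by_cases ha0 : a = 0
  · exact ⟨0, 0, by simp [ha0]⟩
  have hm := hmin a ha ha0
  set m := (D.P b).natDegree with hmdef
  have hβ : (D.P b).coeff m ≠ 0 := Polynomial.leadingCoeff_ne_zero.mpr (D.P_ne_zero hb0)
  have hirr := (IsDiscreteValuationRing.irreducible_iff_uniformizer X).mpr hX
  obtain ⟨i, hi⟩ := IsDiscreteValuationRing.associated_pow_irreducible hβ hirr
  have hd : X ∣ (α ^ n) X := by
    rw [← Ideal.mem_span_singleton, ← hX, ← residue_eq_zero_iff, residue_pow hα,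
      residue_eq_zero_iff, hX]
    exact Ideal.mem_span_singleton_self X
  obtain ⟨t', ht'⟩ : (D.P b).coeff m ∣ (D.P a).coeff n * (α ^ n) (X ^ i) := by
    apply Dvd.dvd.mul_left
    rw [map_pow]
    exact hi.dvd.trans (pow_dvd_pow_of_dvd hd i)
  set y1 : S := D.P.symm (Polynomial.monomial (n - m) ((α.symm ^ m) t')) with hy1
  have hy1d : (D.P y1).natDegree ≤ n - m := by
    rw [hy1, AddEquiv.apply_symm_apply]; exact Polynomial.natDegree_monomial_le _
  have hy1c : (D.P y1).coeff (n - m) = (α.symm ^ m) t' := by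
    rw [hy1, AddEquiv.apply_symm_apply]; simp
  set a' := a * φ X ^ i - b * y1 with ha'
  have ha'K : a' ∈ K := K.sub_mem (mul_mem_right ha _) (mul_mem_right hb _)
  have hc : (D.P a').coeff n = 0 := by
    have h1 : (D.P (b * y1)).coeff (m + (n - m)) = _ := D.coeff_mul_top b y1 m (n - m) le_rfl hy1d
    rw [hy1c, symm_pow_apply', ← ht', show m + (n - m) = n by omega] at h1
    rw [ha', map_sub, Polynomial.coeff_sub, h1, ← map_pow, D.coeff_mul_phi, sub_self]
  have hdeg : (D.P a').natDegree ≤ n := by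
    rw [ha', map_sub]
    refine (Polynomial.natDegree_sub_le _ _).trans (max_le ?_ ?_)
    · refine (D.natDegree_mul_le _ _).trans ?_
      rw [← map_pow, D.natDegree_phi, hn, add_zero]
    · refine (D.natDegree_mul_le _ _).trans ?_
      omega
  by_cases h0 : a' = 0
  · exact ⟨i, y1, sub_eq_zero.mp h0⟩
  · have hlt : (D.P a').natDegree < n := by
      refine lt_of_le_of_ne hdeg fun he => ?_
      rw [← he] at hc
      exact (Polynomial.leadingCoeff_ne_zero.mpr (D.P_ne_zero h0)) hc
    obtain ⟨j, y2, hy2⟩ := ih _ hlt a' ha'K rfl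
    refine ⟨i + j, y1 * φ X ^ j + y2, ?_⟩
    rw [mul_add, ← hy2, ha', sub_mul, pow_add]
    simp only [mul_assoc]
    abel

theorem principal (D : SkewCoeff α φ) (hX : maximalIdeal R = Ideal.span {X})
    (hα : ∀ r, residue R (α r) = residue R r) (J : Submodule Sᵐᵒᵖ S) (c : S) (hc : c ∈ J)
    (hc1 : D.red hα c = 1) :
    ∃ b ∈ J, D.red hα b = 1 ∧ ∀ a ∈ J, ∃ y, a = b * y := by
  classical
  have hc0 : c ≠ 0 := by rintro rfl; simp at hc1
  set K := D.sat hX hα J with hK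
  have hJK : J ≤ K := fun a ha => ⟨0, by simpa using ha⟩
  have hex : ∃ d, ∃ b ∈ K, b ≠ 0 ∧ (D.P b).natDegree = d := ⟨_, c, hJK hc, hc0, rfl⟩
  obtain ⟨b0, hb0K, hb00, hb0d⟩ := Nat.find_spec hex
  have hmin0 : ∀ a ∈ K, a ≠ 0 → (D.P b0).natDegree ≤ (D.P a).natDegree := by
    intro a ha ha0
    rw [hb0d]
    exact Nat.find_min' hex ⟨a, ha, ha0, rfl⟩
  obtain ⟨n, b, hbn, hb⟩ := D.primitive hX hα b0 hb00
  have hbK : b ∈ K := by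
    obtain ⟨i, hi⟩ := hb0K
    refine ⟨n + i, ?_⟩
    rwa [pow_add, ← mul_assoc, ← hbn]
  have hbne : b ≠ 0 := by rintro rfl; simp at hb
  have hdeg : (D.P b).natDegree = (D.P b0).natDegree := by
    have hXn : φ X ^ n ≠ 0 := by
      intro h; rw [h, mul_zero] at hbn; exact hb00 hbn
    rw [hbn, D.natDegree_mul hbne hXn, ← map_pow, D.natDegree_phi, add_zero]
  have hgen : ∀ a ∈ K, ∃ y, a = b * y := by
    intro a ha
    obtain ⟨i, y, hy⟩ := D.division hX hα K b hbK hbne (by rw [hdeg]; exact hmin0) a ha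
    exact D.cancelX hX hα hb i a y hy
  obtain ⟨f0, hf0⟩ := hgen c (hJK hc)
  have hu : IsUnit (D.red hα b) := by
    apply IsUnit.of_mul_eq_one (D.red hα f0)
    rw [← map_mul, ← hf0, hc1]
  obtain ⟨l, hl, hl'⟩ := Polynomial.isUnit_iff.mp hu
  obtain ⟨r, rfl⟩ := residue_surjective l
  have hr : IsUnit r := (residue_ne_zero_iff_isUnit r).mp hl.ne_zero
  obtain ⟨r', hr'⟩ := hr.exists_right_inv
  set b1 := b * φ r' with hb1
  have hb1K : b1 ∈ K := mul_mem_right hbK _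
  have hb1r : D.red hα b1 = 1 := by
    rw [hb1, map_mul, ← hl', red_phi, ← map_mul, ← map_mul, hr', map_one, map_one]
  have hgen1 : ∀ a ∈ K, ∃ y, a = b1 * y := by
    intro a ha
    obtain ⟨y, rfl⟩ := hgen a ha
    refine ⟨φ r * y, ?_⟩
    rw [hb1, mul_assoc, ← mul_assoc (φ r'), ← map_mul, mul_comm r', hr', map_one, one_mul]
  refine ⟨b1, ?_, hb1r, fun a ha => hgen1 a (hJK ha)⟩
  obtain ⟨f, hf⟩ := hgen1 c (hJK hc)
  have hf1 : D.red hα (f - 1) = 0 := by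
    have : D.red hα b1 * D.red hα f = 1 := by rw [← map_mul, ← hf, hc1]
    rw [hb1r, one_mul] at this
    rw [map_sub, this, map_one, sub_self]
  obtain ⟨s, hs⟩ := D.exists_right hX hα hf1
  have key : ∀ n, b1 * φ X ^ n ∈ J → b1 ∈ J := by
    intro n
    induction n with
    | zero => intro h; simpa using h
    | succ n ih =>
      intro h
      apply ih
      obtain ⟨t, ht⟩ := D.pow_comm' hX hα (n + 1) s
      have e : b1 * φ X ^ n = c * φ X ^ n - b1 * φ X ^ (n + 1) * t := by
        have : f = 1 + s * φ X := by rw [← hs]; abel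
        rw [hf, this, mul_assoc b1 (_ ^ (n + 1)), ← ht, pow_succ']
        noncomm_ring
      rw [e]
      exact J.sub_mem (mul_mem_right hc _) (mul_mem_right h _)
  obtain ⟨n, hn⟩ := hb1K
  exact key n hn

theorem rightOre (D : SkewCoeff α φ) (hX : maximalIdeal R = Ideal.span {X})
    (hα : ∀ r, residue R (α r) = residue R r) (a c : S) (hc : D.red hα c = 1) :
    ∃ b d, D.red hα d = 1 ∧ a * d = c * b := by
  set J : Submodule Sᵐᵒᵖ S := Submodule.span Sᵐᵒᵖ {a * φ X, c} with hJ
  obtain ⟨b, hbJ, hb1, hgen⟩ := D.principal hX hα J c (Submodule.subset_span (by simp)) hc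
  obtain ⟨y, hy⟩ := hgen (a * φ X) (Submodule.subset_span (by simp))
  obtain ⟨y', hy'⟩ := D.cancelX hX hα (b := b) (by rw [hb1]; exact one_ne_zero) 1 a y
    (by rw [pow_one, hy])
  have haJ : a ∈ J := by rw [hy']; exact mul_mem_right hbJ _
  obtain ⟨u, v, huv⟩ := Submodule.mem_span_pair.mp haJ
  refine ⟨unop v, 1 - φ X * unop u, ?_, ?_⟩
  · rw [map_sub, map_mul, D.red_X hX]; simp
  · change a * φ X * unop u + c * unop v = a at huv
    rw [mul_sub, mul_one, ← mul_assoc]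
    nth_rewrite 1 [← huv]
    abel

theorem hα_symm (hα : ∀ r, residue R (α r) = residue R r) (r : R) :
    residue R (α.symm r) = residue R r := by
  rw [← hα, RingEquiv.apply_symm_apply]

theorem red_opp (D : SkewCoeff α φ) (hα : ∀ r, residue R (α r) = residue R r) (s : S) :
    D.opp.red (hα_symm hα) (op s) = D.red hα s := by
  ext n
  rw [red_apply, red_apply, Polynomial.coeff_map, Polynomial.coeff_map]
  change residue R ((twist α.symm (D.P s)).coeff n) = _
  rw [coeff_twist, residue_pow (hα_symm hα)]

theorem leftOre (D : SkewCoeff α φ) (hX : maximalIdeal R = Ideal.span {X})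
    (hα : ∀ r, residue R (α r) = residue R r) (a c : S) (hc : D.red hα c = 1) :
    ∃ b d, D.red hα d = 1 ∧ d * a = b * c := by
  obtain ⟨b, d, hd, h⟩ := D.opp.rightOre hX (hα_symm hα) (op a) (op c) ((D.red_opp hα c).trans hc)
  refine ⟨unop b, unop d, ?_, ?_⟩
  · rw [← D.red_opp hα]; exact hd
  · exact congrArg unop h

theorem isUnit_phi_of (D : SkewCoeff α φ) (hα : ∀ r, residue R (α r) = residue R r) {z : S}
    (hz : z ∈ Set.range φ) (h : D.red hα z ≠ 0) : IsUnit z := by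
  obtain ⟨r, rfl⟩ := hz
  rw [red_phi] at h
  apply IsUnit.map
  apply (residue_ne_zero_iff_isUnit r).mp
  intro h'
  simp [h'] at h

theorem typeB_of (D : SkewCoeff α φ) (hX : maximalIdeal R = Ideal.span {X})
    (hα : ∀ r, residue R (α r) = residue R r) {z : S} (hz : ¬ IsUnit z)
    (hu : IsUnit (D.red hα z)) : IsTypeB X φ z := by
  obtain ⟨l, hl, hl'⟩ := Polynomial.isUnit_iff.mp hu
  obtain ⟨r, rfl⟩ := residue_surjective l
  have hr : IsUnit r := (residue_ne_zero_iff_isUnit r).mp hl.ne_zero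
  obtain ⟨v, rfl⟩ := hr
  have h1 : D.red hα (φ ((v⁻¹ : Rˣ) : R) * z) = 1 := by
    rw [map_mul, ← hl', red_phi, ← map_mul, ← map_mul]; simp
  obtain ⟨s, hs⟩ := (D.red_eq_one hX hα _).mp h1
  refine ⟨Units.map (φ : R →* S) v⁻¹, s, ?_, hs⟩
  rintro ⟨r', rfl⟩
  apply hz
  have h2 : IsUnit (φ ((v⁻¹ : Rˣ) : R) * z) := by
    apply D.isUnit_phi_of hα
    · exact ⟨1 + X * r', by rw [hs, map_add, map_mul, map_one]⟩
    · rw [h1]; exact one_ne_zero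
  exact (Units.isUnit_units_mul (Units.map (φ : R →* S) v⁻¹) z).mp h2

theorem natDegree_zero_range (D : SkewCoeff α φ) {z : S} (h : (D.P z).natDegree = 0) :
    z ∈ Set.range φ := by
  refine ⟨(D.P z).coeff 0, ?_⟩
  apply D.P.injective
  rw [D.phi]
  exact (Polynomial.eq_C_of_natDegree_eq_zero h).symm

theorem artinian (D : SkewCoeff α φ) (hX : maximalIdeal R = Ideal.span {X})
    (hα : ∀ r, residue R (α r) = residue R r) {M : Type u} [AddCommGroup M] [Module Sᵐᵒᵖ M]
    (f : S →ₗ[Sᵐᵒᵖ] M) (hf : Function.Surjective f) (c : S) (hc : D.red hα c = 1)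
    (hfc : f c = 0) : IsArtinian Sᵐᵒᵖ M := by
  have hex : ∀ N : Submodule Sᵐᵒᵖ M, ∃ b ∈ N.comap f, D.red hα b = 1 ∧
      ∀ a ∈ N.comap f, ∃ y, a = b * y := fun N =>
    D.principal hX hα _ c (by simp [hfc]) hc
  choose b hbm hb1 hbg using hex
  have hne : ∀ z, D.red hα z = 1 → z ≠ 0 := by rintro z hz rfl; simp at hz
  have hred : ∀ x y z : S, D.red hα x = 1 → D.red hα y = 1 → x = y * z → D.red hα z = 1 := by
    intro x y z hx hy h
    rw [h, map_mul, hy, one_mul] at hx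
    exact hx
  have hle : ∀ N, (D.P (b N)).natDegree ≤ (D.P c).natDegree := by
    intro N
    obtain ⟨y, hy⟩ := hbg N c (by simp [hfc])
    have := hred _ _ _ hc (hb1 N) hy
    rw [hy, D.natDegree_mul (hne _ (hb1 N)) (hne _ this)]
    omega
  refine ⟨Subrelation.wf (r := InvImage (· < ·)
    fun N => (D.P c).natDegree - (D.P (b N)).natDegree) ?_ (InvImage.wf _ wellFounded_lt)⟩
  intro N N' hlt
  change _ - _ < _ - _
  obtain ⟨z, hz⟩ := hbg N' (b N) (Submodule.comap_mono hlt.le (hbm N))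
  have hz1 := hred _ _ _ (hb1 N) (hb1 N') hz
  have hd := D.natDegree_mul (hne _ (hb1 N')) (hne _ hz1)
  rw [← hz] at hd
  have hpos : (D.P z).natDegree ≠ 0 := by
    intro h0
    have hu := D.isUnit_phi_of hα (D.natDegree_zero_range h0) (by rw [hz1]; exact one_ne_zero)
    obtain ⟨w, hw⟩ := hu.exists_right_inv
    apply not_le_of_gt hlt
    intro x hx
    obtain ⟨a, rfl⟩ := hf x
    obtain ⟨y, hy⟩ := hbg N' a hx
    have : a = b N * (w * y) := by
      rw [hz, mul_assoc, ← mul_assoc z, hw, one_mul, hy]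
    have hm : a ∈ N.comap f := by rw [this]; exact mul_mem_right (hbm N) _
    exact hm
  have := hle N
  omega

theorem simple_typeB (D : SkewCoeff α φ) (hX : maximalIdeal R = Ideal.span {X})
    (hα : ∀ r, residue R (α r) = residue R r) {M : Type u} [AddCommGroup M] [Module Sᵐᵒᵖ M]
    [IsSimpleModule Sᵐᵒᵖ M]
    (f : S →ₗ[Sᵐᵒᵖ] M) (hf : Function.Surjective f) (c : S) (hc : D.red hα c = 1)
    (hfc : f c = 0) : ∃ b : S, Irreducible b ∧ IsTypeB X φ b ∧
      Nonempty (M ≃ₗ[Sᵐᵒᵖ] rQuot S b) := by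
  obtain ⟨b, hbJ, hb1, hgen⟩ := D.principal hX hα (LinearMap.ker f) c hfc hc
  have hker : LinearMap.ker f = rSpan S b := by
    apply le_antisymm
    · intro a ha
      obtain ⟨y, rfl⟩ := hgen a ha
      exact mul_mem_right (Submodule.mem_span_singleton_self b) y
    · rw [Submodule.span_singleton_le_iff_mem]; exact hbJ
  have hnu : ¬ IsUnit b := by
    intro hu
    obtain ⟨w, hw⟩ := hu.exists_right_inv
    have h1 : (1 : S) ∈ LinearMap.ker f := by rw [← hw]; exact mul_mem_right hbJ w
    have := IsSimpleModule.nontrivial Sᵐᵒᵖ M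
    obtain ⟨x, hx⟩ := exists_ne (0 : M)
    obtain ⟨a, rfl⟩ := hf x
    apply hx
    have := mul_mem_right h1 a
    rwa [one_mul] at this
  have hbne : b ≠ 0 := by rintro rfl; simp at hb1
  refine ⟨b, ⟨hnu, ?_⟩, D.typeB_of hX hα hnu (by rw [hb1]; exact isUnit_one), ?_⟩
  · intro x y hxy
    have hS : ∀ N : Submodule Sᵐᵒᵖ M, N = ⊥ ∨ N = ⊤ := fun N => eq_bot_or_eq_top N
    rcases hS ((rSpan S x).map f) with h | h
    · right
      have hx : x ∈ LinearMap.ker f := by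
        have : f x ∈ (rSpan S x).map f :=
          Submodule.mem_map_of_mem (Submodule.mem_span_singleton_self x)
        rw [h] at this
        exact this
      obtain ⟨z, hz⟩ := hgen x hx
      have := D.noZeroDivisors
      have := D.nontriv
      have : IsDomain S := NoZeroDivisors.to_isDomain S
      have hzy : b * (z * y) = b * 1 := by rw [← mul_assoc, ← hz, ← hxy, mul_one]
      have hzy1 := mul_left_cancel₀ hbne hzy
      have hzu := D.isUnit_of_right hzy1
      obtain ⟨w, rfl⟩ := hzu
      exact (Units.isUnit_units_mul w y).mp (by rw [hzy1]; exact isUnit_one)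
    · left
      have : f 1 ∈ (rSpan S x).map f := by rw [h]; trivial
      obtain ⟨p, hp, hp1⟩ := this
      obtain ⟨t, rfl⟩ := Submodule.mem_span_singleton.mp hp
      have h1 : 1 - x * unop t ∈ LinearMap.ker f := by
        rw [LinearMap.mem_ker, map_sub, sub_eq_zero]
        exact hp1.symm
      obtain ⟨z, hz⟩ := hgen _ h1
      apply D.isUnit_of_right (b := unop t + y * z)
      rw [mul_add, ← mul_assoc, ← hxy, ← hz]; abel
  · exact ⟨((LinearMap.quotKerEquivOfSurjective f hf).symm).trans
      (Submodule.quotEquivOfEq _ _ hker)⟩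

/-- The orbit map of an element of a right module. -/
def orbit {M : Type u} [AddCommGroup M] [Module Sᵐᵒᵖ M] (e : M) : S →ₗ[Sᵐᵒᵖ] M where
  toFun s := op s • e
  map_add' s t := by rw [op_add, add_smul]
  map_smul' t s := by
    change op (s * unop t) • e = t • op s • e
    rw [op_mul, mul_smul]; rfl

theorem fg_artinian (D : SkewCoeff α φ) (hX : maximalIdeal R = Ideal.span {X})
    (hα : ∀ r, residue R (α r) = residue R r) {M : Type u} [AddCommGroup M] [Module Sᵐᵒᵖ M]
    (N : Submodule Sᵐᵒᵖ M) (hN : ∀ e ∈ N, ∃ c, D.red hα c = 1 ∧ op c • e = 0)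
    (hfg : N.FG) : IsArtinian Sᵐᵒᵖ N := by
  induction N, hfg using Submodule.fg_induction with
  | singleton e =>
    obtain ⟨c, hc, hce⟩ := hN e (Submodule.mem_span_singleton_self e)
    refine D.artinian hX hα
      (orbit (⟨e, Submodule.mem_span_singleton_self e⟩ : Submodule.span Sᵐᵒᵖ {e})) ?_ c hc ?_
    · rintro ⟨x, hx⟩
      obtain ⟨t, rfl⟩ := Submodule.mem_span_singleton.mp hx
      exact ⟨unop t, rfl⟩
    · exact Subtype.ext hce
  | sup M₁ M₂ _ _ h₁ h₂ =>
    have := h₁ (fun e he => hN e (Submodule.mem_sup_left he))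
    have := h₂ (fun e he => hN e (Submodule.mem_sup_right he))
    infer_instance

theorem subquot_typeB (D : SkewCoeff α φ) (hX : maximalIdeal R = Ideal.span {X})
    (hα : ∀ r, residue R (α r) = residue R r) {M : Type u} [AddCommGroup M] [Module Sᵐᵒᵖ M]
    (A B : Submodule Sᵐᵒᵖ M) (hN : ∀ e ∈ A, ∃ c, D.red hα c = 1 ∧ op c • e = 0)
    (hs : IsSimpleModule Sᵐᵒᵖ (↥A ⧸ Submodule.comap A.subtype B)) :
    ∃ b : S, Irreducible b ∧ IsTypeB X φ b ∧
      Nonempty ((↥A ⧸ Submodule.comap A.subtype B) ≃ₗ[Sᵐᵒᵖ] rQuot S b) := by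
  have := IsSimpleModule.nontrivial Sᵐᵒᵖ (↥A ⧸ Submodule.comap A.subtype B)
  obtain ⟨x, hx⟩ := exists_ne (0 : ↥A ⧸ Submodule.comap A.subtype B)
  obtain ⟨⟨a, ha⟩, rfl⟩ := Submodule.Quotient.mk_surjective _ x
  obtain ⟨c, hc, hca⟩ := hN a ha
  refine D.simple_typeB hX hα (orbit (Submodule.Quotient.mk ⟨a, ha⟩)) ?_ c hc ?_
  · rw [← LinearMap.range_eq_top]
    apply (eq_bot_or_eq_top _).resolve_left
    intro h
    apply hx
    rw [LinearMap.range_eq_bot] at h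
    have := LinearMap.congr_fun h (1 : S)
    simpa [orbit] using this
  · change op c • (Submodule.Quotient.mk ⟨a, ha⟩ : ↥A ⧸ Submodule.comap A.subtype B) = 0
    rw [← Submodule.Quotient.mk_smul]
    rw [Submodule.Quotient.mk_eq_zero]
    have : op c • (⟨a, ha⟩ : A) = 0 := Subtype.ext hca
    rw [this]; exact Submodule.zero_mem _

end main
end SkewCoeff

namespace SkewCoeff

theorem theta_left {R S : Type u} [CommRing R] [Ring S] {α : R ≃+* R} {φ : R →+* S} {θ : S}
    (h : IsSkewPolynomialRing α φ θ) (s : S) : ∃ s', θ * s = s' * θ := by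
  obtain ⟨p, rfl⟩ := (evalEquiv h).surjective s
  induction p using Finsupp.induction_linear with
  | zero => exact ⟨0, by simp⟩
  | add p q hp hq =>
    obtain ⟨a, ha⟩ := hp
    obtain ⟨b, hb⟩ := hq
    exact ⟨a + b, by rw [map_add, mul_add, ha, hb, add_mul]⟩
  | single n r =>
    refine ⟨φ (α r) * θ ^ n, ?_⟩
    rw [evalEquiv_single, ← mul_assoc, h.commutes, mul_assoc, mul_assoc, ← pow_succ, ← pow_succ']

theorem theta_right {R S : Type u} [CommRing R] [Ring S] {α : R ≃+* R} {φ : R →+* S} {θ : S}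
    (h : IsSkewPolynomialRing α φ θ) (s : S) : ∃ s', s * θ = θ * s' := by
  obtain ⟨p, rfl⟩ := (evalEquiv h).surjective s
  induction p using Finsupp.induction_linear with
  | zero => exact ⟨0, by simp⟩
  | add p q hp hq =>
    obtain ⟨a, ha⟩ := hp
    obtain ⟨b, hb⟩ := hq
    exact ⟨a + b, by rw [map_add, add_mul, ha, hb, mul_add]⟩
  | single n r =>
    refine ⟨φ (α.symm r) * θ ^ n, ?_⟩
    rw [evalEquiv_single, ← mul_assoc, h.commutes, mul_assoc, mul_assoc, ← pow_succ, ← pow_succ',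
      RingEquiv.apply_symm_apply]

theorem residue_alg {k R : Type u} [Field k] [CommRing R] [IsLocalRing R] [Algebra k R]
    (hres : Function.Bijective ((IsLocalRing.residue R).comp (algebraMap k R)))
    (α : R ≃ₐ[k] R) (r : R) :
    IsLocalRing.residue R (α.toRingEquiv r) = IsLocalRing.residue R r := by
  obtain ⟨c, hc⟩ := hres.2 (IsLocalRing.residue R r)
  change IsLocalRing.residue R (algebraMap k R c) = _ at hc
  change IsLocalRing.residue R (α r) = _
  rw [← hc]
  rw [← sub_eq_zero, ← map_sub, IsLocalRing.residue_eq_zero_iff, IsLocalRing.mem_maximalIdeal,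
    mem_nonunits_iff] at hc ⊢
  have h1 : α r - algebraMap k R c = α (r - algebraMap k R c) := by
    rw [map_sub, AlgEquiv.commutes]
  rw [h1, MulEquiv.isUnit_map, ← neg_sub, IsUnit.neg_iff]
  exact hc

end SkewCoeff

/-- Let `V` be a faithful simple right `S`-module (with its `T`-module
structure) and `𝒞 = {1 + Xs : s ∈ S}`.  Then (1) `𝒞` is an `α`-invariant Ore set in `S`;
(2) the set `W` of `𝒞`-torsion elements of `E_T(V)` is a nonzero `T`-submodule;
(3) every factorization of an element of `𝒞` into irreducibles of `S` has all factors of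
type (B); (4) as an `S`-module `W` is locally Artinian, with all composition factors of
its finitely generated submodules type (B) simple modules. -/
theorem C_torsion_submodule_of_injective_hull
    {k : Type u} [Field k]
    {R : Type u} [CommRing R] [IsDomain R] [IsDiscreteValuationRing R] [Algebra k R]
    (X : R) (hX : IsLocalRing.maximalIdeal R = Ideal.span {X})
    (hres : Function.Bijective ((IsLocalRing.residue R).comp (algebraMap k R)))
    (α : R ≃ₐ[k] R) (hord : ∀ n : ℕ, 0 < n → α ^ n ≠ 1)
    {S : Type u} [Ring S] (φ : R →+* S) (θ : S)
    (hS : IsSkewPolynomialRing α.toRingEquiv φ θ)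
    {T : Type u} [Ring T] (ψ : S →+* T) (hT : IsLocalizationAt (φ X) ψ)
    (V : Type u) [AddCommGroup V] [Module Tᵐᵒᵖ V]
    (hV : letI : Module Sᵐᵒᵖ V := restrictOp ψ V
      IsSimpleModule Sᵐᵒᵖ V ∧ FaithfulSMul Sᵐᵒᵖ V)
    (E : Type u) [AddCommGroup E] [Module Tᵐᵒᵖ E] (g : V →ₗ[Tᵐᵒᵖ] E)
    (hg : IsInjectiveHullVia Tᵐᵒᵖ g) :
    -- (1) `𝒞` is a multiplicatively closed, left and right Ore, `α`-invariant set
    ((1 : S) ∈ {c : S | ∃ s : S, c = 1 + φ X * s} ∧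
     (∀ c d : S, c ∈ {c : S | ∃ s : S, c = 1 + φ X * s} →
        d ∈ {c : S | ∃ s : S, c = 1 + φ X * s} →
        c * d ∈ {c : S | ∃ s : S, c = 1 + φ X * s}) ∧
     (∀ (a c : S), (∃ s : S, c = 1 + φ X * s) →
        ∃ (b d : S), (∃ s : S, d = 1 + φ X * s) ∧ a * d = c * b) ∧
     (∀ (a c : S), (∃ s : S, c = 1 + φ X * s) →
        ∃ (b d : S), (∃ s : S, d = 1 + φ X * s) ∧ d * a = b * c) ∧
     (∀ c : S, (∃ s : S, c = 1 + φ X * s) →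
        ∃ c' : S, (∃ s : S, c' = 1 + φ X * s) ∧ θ * c = c' * θ) ∧
     (∀ c : S, (∃ s : S, c = 1 + φ X * s) →
        ∃ c' : S, (∃ s : S, c' = 1 + φ X * s) ∧ c * θ = θ * c')) ∧
    -- (2) the `𝒞`-torsion elements form a nonzero `T`-submodule `W` of `E`
    (∃ W : Submodule Tᵐᵒᵖ E,
      (∀ e : E, e ∈ W ↔ ∃ c : S, (∃ s : S, c = 1 + φ X * s) ∧ op (ψ c) • e = 0) ∧
      W ≠ ⊥ ∧
      -- (4) as an `S`-module, `W` is locally Artinian with all composition factors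
      -- of finitely generated submodules being type (B) simple modules
      (letI : Module Sᵐᵒᵖ E := restrictOp ψ E
       (∀ N : Submodule Sᵐᵒᵖ E, (N : Set E) ⊆ (W : Set E) → N.FG → IsArtinian Sᵐᵒᵖ N) ∧
       (∀ A B : Submodule Sᵐᵒᵖ E, (A : Set E) ⊆ (W : Set E) → B ≤ A →
          IsSimpleModule Sᵐᵒᵖ (↥A ⧸ Submodule.comap A.subtype B) →
          ∃ b : S, Irreducible b ∧ IsTypeB X φ b ∧
            Nonempty ((↥A ⧸ Submodule.comap A.subtype B) ≃ₗ[Sᵐᵒᵖ] rQuot S b)))) ∧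
    -- (3) factorizations of elements of `𝒞` into irreducibles have type (B) factors
    (∀ (c : S), (∃ s : S, c = 1 + φ X * s) → ∀ l : List S,
      (∀ x ∈ l, Irreducible x) → l.prod = c → ∀ x ∈ l, IsTypeB X φ x) := by
  have hα : ∀ r, IsLocalRing.residue R (α.toRingEquiv r) = IsLocalRing.residue R r :=
    SkewCoeff.residue_alg hres α
  set D := SkewCoeff.ofSkew hS with hD
  have hC := D.red_eq_one hX hα
  simp only [Set.mem_ofPred_eq, ← hC]
  have hθ : D.red hα θ ≠ 0 := by
    have h1 : D.P θ = Polynomial.X := by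
      have := SkewCoeff.equivP_monomial hS 1 1
      rw [map_one, one_mul, pow_one] at this
      exact this
    rw [SkewCoeff.red_apply, h1, Polynomial.map_X]
    exact Polynomial.X_ne_zero
  refine ⟨⟨map_one _, fun c d hc hd => by rw [map_mul, hc, hd, one_mul],
    fun a c hc => D.rightOre hX hα a c hc, fun a c hc => D.leftOre hX hα a c hc, ?_, ?_⟩, ?_, ?_⟩
  · intro c hc
    obtain ⟨c', hc'⟩ := SkewCoeff.theta_left hS c
    refine ⟨c', ?_, hc'⟩
    have h2 := congrArg (D.red hα) hc'
    rw [map_mul, map_mul, hc, mul_one] at h2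
    exact (mul_eq_right₀ hθ).mp h2.symm
  · intro c hc
    obtain ⟨c', hc'⟩ := SkewCoeff.theta_right hS c
    refine ⟨c', ?_, hc'⟩
    have h2 := congrArg (D.red hα) hc'
    rw [map_mul, map_mul, hc, one_mul] at h2
    exact (mul_eq_left₀ hθ).mp h2.symm
  · have hsmul : ∀ (s : S) (e : E), (∃ c, D.red hα c = 1 ∧ op (ψ c) • e = 0) →
        ∃ c, D.red hα c = 1 ∧ op (ψ c) • (op (ψ s) • e) = 0 := by
      rintro s e ⟨c, hc, hce⟩
      obtain ⟨b, d, hd, h⟩ := D.rightOre hX hα s c hc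
      refine ⟨d, hd, ?_⟩
      rw [← mul_smul, ← op_mul, ← map_mul, h, map_mul, op_mul, mul_smul, hce, smul_zero]
    have hinv : ∀ e : E, (∃ c, D.red hα c = 1 ∧ op (ψ c) • (op (ψ (φ X)) • e) = 0) →
        ∃ c, D.red hα c = 1 ∧ op (ψ c) • e = 0 := by
      rintro e ⟨c, hc, hce⟩
      obtain ⟨s, rfl⟩ := (hC c).mp hc
      obtain ⟨t, ht⟩ := D.X_comm hX hα (φ X * s)
      have h1 : D.red hα t = 0 := by
        obtain ⟨t', ht'⟩ := D.X_comm hX hα s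
        have h2 : t = φ X * t' := by
          have := D.noZeroDivisors
          have := D.nontriv
          have : IsDomain S := NoZeroDivisors.to_isDomain S
          apply mul_right_cancel₀ (D.phiX_ne hX)
          rw [← ht, ht', mul_assoc]
        rw [h2, map_mul, D.red_X hX, zero_mul]
      refine ⟨1 + t, by rw [map_add, h1, map_one, add_zero], ?_⟩
      have h3 : φ X * (1 + φ X * s) = (1 + t) * φ X := by
        rw [mul_add, ht, add_mul, mul_one, one_mul]
      rw [← mul_smul, ← op_mul, ← map_mul, h3, map_mul, op_mul, mul_smul] at hce
      obtain ⟨u, hu⟩ := hT.unit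
      rw [← hu] at hce
      have h4 := congrArg (fun x => op ((u⁻¹ : Tˣ) : T) • x) hce
      simp only [smul_zero, ← mul_smul, ← op_mul] at h4
      rw [mul_assoc, Units.mul_inv, mul_one] at h4
      exact h4
    have hinvn : ∀ (n : ℕ) (e : E),
        (∃ c, D.red hα c = 1 ∧ op (ψ c) • (op (ψ (φ X) ^ n) • e) = 0) →
        ∃ c, D.red hα c = 1 ∧ op (ψ c) • e = 0 := by
      intro n
      induction n with
      | zero => intro e h; simpa using h
      | succ n ih =>
        intro e h
        apply ih
        apply hinv
        rw [pow_succ, op_mul] at h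
        simpa only [mul_smul] using h
    let W : Submodule Tᵐᵒᵖ E :=
      { carrier := {e | ∃ c, D.red hα c = 1 ∧ op (ψ c) • e = 0}
        zero_mem' := ⟨1, map_one _, smul_zero _⟩
        add_mem' := by
          rintro e₁ e₂ ⟨c, hc, h1⟩ ⟨c', hc', h2⟩
          obtain ⟨b, d, hd, h⟩ := D.rightOre hX hα c c' hc'
          refine ⟨c * d, by rw [map_mul, hc, hd, one_mul], ?_⟩
          rw [smul_add]
          have h3 : op (ψ (c * d)) • e₁ = 0 := by
            rw [map_mul, op_mul, mul_smul, h1, smul_zero]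
          have h4 : op (ψ (c * d)) • e₂ = 0 := by
            rw [h, map_mul, op_mul, mul_smul, h2, smul_zero]
          rw [h3, h4, add_zero]
        smul_mem' := by
          intro t e he
          obtain ⟨s, n, hs⟩ := hT.surj (unop t)
          apply hinvn n
          have h5 : op (ψ (φ X) ^ n) • t • e = op (ψ s) • e := by
            rw [← mul_smul, ← hs, op_mul, op_unop]
          rw [h5]
          exact hsmul s e he }
    refine ⟨W, fun e => Iff.rfl, ?_, ?_, ?_⟩
    · let _ : Module Sᵐᵒᵖ V := restrictOp ψ V
      obtain ⟨hsimp, -⟩ := hV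
      have := IsSimpleModule.nontrivial Sᵐᵒᵖ V
      obtain ⟨v, hv⟩ := exists_ne (0 : V)
      have hvX : op (φ X) • v ≠ 0 := by
        intro h0
        change op (ψ (φ X)) • v = 0 at h0
        obtain ⟨u, hu⟩ := hT.unit
        rw [← hu] at h0
        have h4 := congrArg (fun x => op ((u⁻¹ : Tˣ) : T) • x) h0
        simp only [smul_zero, ← mul_smul, ← op_mul] at h4
        rw [Units.mul_inv, op_one, one_smul] at h4
        exact hv h4
      have hspan : Submodule.span Sᵐᵒᵖ {op (φ X) • v} = ⊤ := by
        apply (eq_bot_or_eq_top _).resolve_left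
        rw [Submodule.span_singleton_eq_bot]
        exact hvX
      have hvm : v ∈ Submodule.span Sᵐᵒᵖ {op (φ X) • v} := by rw [hspan]; trivial
      obtain ⟨t, ht⟩ := Submodule.mem_span_singleton.mp hvm
      have hker : op (1 - φ X * unop t) • v = 0 := by
        rw [op_sub, sub_smul, op_one, one_smul, op_mul, op_unop, mul_smul, ht, sub_self]
      intro hW
      have hgv : g v ∈ W := by
        refine ⟨1 - φ X * unop t, ?_, ?_⟩
        · rw [map_sub, map_mul, D.red_X hX]; simp
        · rw [← map_smul]
          have : op (ψ (1 - φ X * unop t)) • v = 0 := hker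
          rw [this, map_zero]
      rw [hW, Submodule.mem_bot] at hgv
      apply hv
      apply hg.2.1
      rw [hgv, map_zero]
    · let _ : Module Sᵐᵒᵖ E := restrictOp ψ E
      intro N hN hfg
      exact D.fg_artinian hX hα N (fun e he => hN he) hfg
    · let _ : Module Sᵐᵒᵖ E := restrictOp ψ E
      intro A B hA hBA hs
      exact D.subquot_typeB hX hα A B (fun e he => hA he) hs
  · intro c hc l hl hprod x hx
    apply D.typeB_of hX hα (hl x hx).not_isUnit
    have h1 : (l.map (D.red hα)).prod = 1 := by
      rw [← map_list_prod, hprod, hc]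
    apply isUnit_of_dvd_one
    rw [← h1]
    exact List.dvd_prod (List.mem_map_of_mem hx)
end
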